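/- arXiv:math/0112186 — 3 statements merged into one kernel-verified Lean document; each statement's English description precedes it below -/
import Mathlib

section
/- Fix a positive integer k and positive integers n_1,…,n_k. Then for every integer l with 1 ≤ l ≤ k, there exists a finite set of distinct points X in ℙ^{n_1} × ⋯ × ℙ^{n_k} such that depth R/I_X = l. Explicitly, with P_i = [1:0:⋯:0] ∈ ℙ^{n_i} and Q_i = [0:1:0:⋯:0] ∈ ℙ^{n_i}, the two-point set X_l = {P_1 × P_2 × ⋯ × P_k, P_1 × ⋯ × P_{l−1} × Q_l × ⋯ × Q_k} satisfies depth R/I_{X_l} = l. -/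
open MvPolynomial

noncomputable section

namespace PaperMP

variable (K : Type) [Field K] [IsAlgClosed K] [CharZero K]
variable (k : ℕ) (n : Fin k → ℕ)

/-- Index type of the variables `x_{i,j}`, `1 ≤ i ≤ k`, `0 ≤ j ≤ n i`. -/
abbrev Sig := Σ i : Fin k, Fin (n i + 1)

/-- The `ℕ^k`-graded polynomial ring `R`. -/
abbrev MPRing := MvPolynomial (Sig k n) K

/-- The grading of `R`: `deg x_{i,j} = e_i`. -/
def wt : Sig k n → (Fin k → ℕ) := fun p => Pi.single p.1 1

/-- A point of `ℙ^{n_1} × ⋯ × ℙ^{n_k}`. -/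
abbrev MPPoint := ∀ i : Fin k, Projectivization K (Fin (n i + 1) → K)

/-- The affine cone over a point of multiprojective space. -/
def cone (P : MPPoint K k n) : Set (Sig k n → K) :=
  {x | ∀ i : Fin k, ∃ c : K, (fun j => x ⟨i, j⟩) = c • (P i).rep}

/-- Vanishing ideal of a set of points of affine space. -/
def vanishingIdeal (T : Set (Sig k n → K)) : Ideal (MPRing K k n) :=
  ⨅ x ∈ T, RingHom.ker (MvPolynomial.eval x)

/-- The (prime) ideal `I_P` of a point of multiprojective space. -/
def idealOfPoint (P : MPPoint K k n) : Ideal (MPRing K k n) :=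
  vanishingIdeal K k n (cone K k n P)

/-- The ideal `I_X` of a set of points of multiprojective space. -/
def idealOfSet (X : Set (MPPoint K k n)) : Ideal (MPRing K k n) :=
  ⨅ P ∈ X, idealOfPoint K k n P

/-- The Hilbert function of `R/I` in multidegree `d`. -/
def hilb (I : Ideal (MPRing K k n)) (d : Fin k → ℕ) : ℕ :=
  Module.finrank K ((weightedHomogeneousSubmodule K (wt k n) d).map
    (Ideal.Quotient.mkₐ K I).toLinearMap)

/-- The irrelevant maximal ideal `m = (x_{1,0},…,x_{k,n_k})`. -/
def maxIdeal : Ideal (MPRing K k n) :=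
  Ideal.span (Set.range (MvPolynomial.X : Sig k n → MPRing K k n))

/-- `L` is a regular sequence modulo `I`:  `(I,L) ⊆ m`, and each entry is a
non-zero divisor modulo `I` together with the previous entries. -/
def IsRegSeqMod (I : Ideal (MPRing K k n)) (L : List (MPRing K k n)) : Prop :=
  I ⊔ Ideal.span {f | f ∈ L} ≤ maxIdeal K k n ∧
  ∀ i : Fin L.length, ∀ G : MPRing K k n,
    L.get i * G ∈ I ⊔ Ideal.span {f | f ∈ L.take i} →
      G ∈ I ⊔ Ideal.span {f | f ∈ L.take i}

/-- `depth R/I = l`: `l` is the length of a maximal regular sequence modulo `I`. -/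
def hasDepth (I : Ideal (MPRing K k n)) (l : ℕ) : Prop :=
  IsGreatest {r : ℕ | ∃ L : List (MPRing K k n), L.length = r ∧ IsRegSeqMod K k n I L} l

/-- `X` is arithmetically Cohen–Macaulay: `depth R/I_X = K-dim R/I_X = k`. -/
def IsACM (X : Set (MPPoint K k n)) : Prop :=
  hasDepth K k n (idealOfSet K k n X) k

/-! ### The first difference function -/

/-- Extend `H : ℕ^k → ℕ` by zero outside ℕ^k. -/
def extNeg (H : (Fin k → ℕ) → ℕ) (j : Fin k → ℤ) : ℤ :=
  if ∀ i, 0 ≤ j i then H (fun i => (j i).toNat) else 0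

/-- The first difference function `ΔH` of a numerical function `H : ℕ^k → ℕ`. -/
def delta (H : (Fin k → ℕ) → ℕ) (d : Fin k → ℕ) : ℤ :=
  ∑ l : Fin k → Fin 2, (-1 : ℤ) ^ (∑ i, (l i : ℕ)) *
    extNeg k H (fun i => (d i : ℤ) - (l i : ℕ))

/-! ### The ring `S = k[x_{1,1},…,x_{k,n_k}]` -/

/-- Index type of the variables `x_{i,j}`, `1 ≤ i ≤ k`, `1 ≤ j ≤ n i`. -/
abbrev SigS := Σ i : Fin k, Fin (n i)

/-- The `ℕ^k`-graded polynomial ring `S`. -/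
abbrev SRing := MvPolynomial (SigS k n) K

/-- The grading of `S`: `deg x_{i,j} = e_i`. -/
def wtS : SigS k n → (Fin k → ℕ) := fun p => Pi.single p.1 1

/-- The Hilbert function of `S/J` in multidegree `d`. -/
def hilbS (J : Ideal (SRing K k n)) (d : Fin k → ℕ) : ℕ :=
  Module.finrank K ((weightedHomogeneousSubmodule K (wtS k n) d).map
    (Ideal.Quotient.mkₐ K J).toLinearMap)

/-- `J` is an `ℕ^k`-homogeneous ideal of `S`. -/
def IsHomogIdealS (J : Ideal (SRing K k n)) : Prop :=
  ∀ f ∈ J, ∀ d : Fin k → ℕ, weightedHomogeneousComponent (wtS k n) d f ∈ J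

/-- `J` is an artinian ideal of `S`: `√J = (x_{1,1},…,x_{k,n_k})`. -/
def IsArtinianIdealS (J : Ideal (SRing K k n)) : Prop :=
  J.radical = Ideal.span (Set.range (MvPolynomial.X : SigS k n → SRing K k n))

/-! ### The ring `k[x_1,…,x_k]`, with `deg x_i = e_i` -/

abbrev TRing := MvPolynomial (Fin k) K

/-- The grading: `deg x_i = e_i`. -/
def wtT : Fin k → (Fin k → ℕ) := fun i => Pi.single i 1

/-- The Hilbert function of `k[x_1,…,x_k]/I` in multidegree `d`. -/
def hilbT (I : Ideal (TRing K k)) (d : Fin k → ℕ) : ℕ :=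
  Module.finrank K ((weightedHomogeneousSubmodule K (wtT k) d).map
    (Ideal.Quotient.mkₐ K I).toLinearMap)

/-- `I` is an `ℕ^k`-homogeneous ideal of `k[x_1,…,x_k]`. -/
def IsHomogIdealT (I : Ideal (TRing K k)) : Prop :=
  ∀ f ∈ I, ∀ d : Fin k → ℕ, weightedHomogeneousComponent (wtT k) d f ∈ I

/-- `I` is an artinian ideal of `k[x_1,…,x_k]`: `√I = (x_1,…,x_k)`. -/
def IsArtinianIdealT (I : Ideal (TRing K k)) : Prop :=
  I.radical = Ideal.span (Set.range (MvPolynomial.X : Fin k → TRing K k))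

/-! ### Lifting monomial ideals -/

/-- The lift `m̄ = ∏_{i,j} ∏_{l=1}^{a_{i,j}} (x_{i,j} - (l-1) x_{i,0})` of the monomial
of `S` with exponent vector `b`, via the lifting matrix `𝒜`. -/
def liftMonomial (b : SigS k n →₀ ℕ) : MPRing K k n :=
  ∏ p ∈ b.support, ∏ l ∈ Finset.range (b p),
    (MvPolynomial.X (⟨p.1, p.2.succ⟩ : Sig k n) - (l : MPRing K k n) * MvPolynomial.X ⟨p.1, 0⟩)

/-- `J` is a monomial ideal of `S`. -/
def IsMonomialIdeal (J : Ideal (SRing K k n)) : Prop :=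
  ∃ A : Set (SigS k n →₀ ℕ), J = Ideal.span ((fun b => (monomial b (1 : K) : SRing K k n)) '' A)

/-- The exponent vectors of the minimal monomial generators of a monomial ideal `J ⊆ S`. -/
def minGens (J : Ideal (SRing K k n)) : Set (SigS k n →₀ ℕ) :=
  {b | (monomial b (1 : K) : SRing K k n) ∈ J ∧
    ∀ b' : SigS k n →₀ ℕ, b' ≤ b → b' ≠ b → (monomial b' (1 : K) : SRing K k n) ∉ J}

/-- The lift to `R` of a monomial ideal `J ⊆ S`, generated by the lifts of the
minimal monomial generators of `J`. -/
def liftIdeal (J : Ideal (SRing K k n)) : Ideal (MPRing K k n) :=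
  Ideal.span (liftMonomial K k n '' minGens K k n J)

/-- The projection `R → S ≅ R/(x_{1,0},…,x_{k,0})` sending `x_{i,0} ↦ 0` and
`x_{i,j} ↦ x_{i,j}` for `j ≥ 1`. -/
def projToS : MPRing K k n →ₐ[K] SRing K k n :=
  aeval (fun p : Sig k n =>
    if h : p.2 = 0 then 0 else MvPolynomial.X (⟨p.1, p.2.pred h⟩ : SigS k n))

/-- The point `[1:b_{i,1}:⋯:b_{i,n_i}] × ⋯` of multiprojective space associated to the
exponent vector `b` of a monomial of `S`. -/
def monToPoint (b : SigS k n →₀ ℕ) : MPPoint K k n := fun i =>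
  Projectivization.mk K
    (fun j : Fin (n i + 1) => if h : j = 0 then 1 else ((b ⟨i, j.pred h⟩ : ℕ) : K))
    (fun hc => by simpa using congrFun hc 0)

/-! ### Partitions -/

/-- `lam` is a partition: positive non-increasing entries. -/
def IsPartition {t : ℕ} (lam : Fin t → ℕ) : Prop :=
  (∀ j, 0 < lam j) ∧ Antitone lam

/-- `lam` is a partition of `s`. -/
def IsPartitionOf (s : ℕ) {t : ℕ} (lam : Fin t → ℕ) : Prop :=
  IsPartition lam ∧ ∑ j, lam j = s

/-- The `(i+1)`-st entry `λ*_{i+1} = #{j : λ_j ≥ i+1}` of the conjugate partition. -/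
def conjEntry {t : ℕ} (lam : Fin t → ℕ) (i : ℕ) : ℕ :=
  (Finset.univ.filter fun j : Fin t => i + 1 ≤ lam j).card

/-- `β` is the conjugate partition `α*` of `α`. -/
def IsConjugateOf {t m : ℕ} (α : Fin t → ℕ) (β : Fin m → ℕ) : Prop :=
  (∀ i : Fin m, β i = conjEntry α i) ∧ ∀ i : ℕ, m ≤ i → conjEntry α i = 0

/-! ### `ℙ^1 × ℙ^1` -/

/-- A point of `ℙ^1`. -/
abbrev Proj1 := Projectivization K (Fin 2 → K)

/-- A point of `ℙ^1 × ℙ^1`. -/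
abbrev Pt2 := MPPoint K 2 (fun _ => 1)

/-- The coordinate ring of `ℙ^1 × ℙ^1`. -/
abbrev R2 := MPRing K 2 (fun _ => 1)

/-- `P` enumerates the distinct first coordinates of `X` and `α` lists the sizes of the
corresponding fibers, in non-increasing order; so `α = α_X`. -/
def IsAlphaLabel (X : Set (Pt2 K)) {t : ℕ} (P : Fin t → Proj1 K) (α : Fin t → ℕ) : Prop :=
  Function.Injective P ∧ (Set.range P = (fun Z : Pt2 K => Z 0) '' X) ∧
  (∀ i, α i = Set.ncard {Z | Z ∈ X ∧ Z 0 = P i}) ∧ Antitone α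

/-- `Q` enumerates the distinct second coordinates of `X` and `β` lists the sizes of the
corresponding fibers, in non-increasing order; so `β = β_X`. -/
def IsBetaLabel (X : Set (Pt2 K)) {r : ℕ} (Q : Fin r → Proj1 K) (β : Fin r → ℕ) : Prop :=
  Function.Injective Q ∧ (Set.range Q = (fun Z : Pt2 K => Z 1) '' X) ∧
  (∀ i, β i = Set.ncard {Z | Z ∈ X ∧ Z 1 = Q i}) ∧ Antitone β

/-- `α = α_X`. -/
def IsAlphaPartition (X : Set (Pt2 K)) {t : ℕ} (α : Fin t → ℕ) : Prop :=
  ∃ P : Fin t → Proj1 K, IsAlphaLabel K X P α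

/-- `β = β_X`. -/
def IsBetaPartition (X : Set (Pt2 K)) {r : ℕ} (β : Fin r → ℕ) : Prop :=
  ∃ Q : Fin r → Proj1 K, IsBetaLabel K X Q β

/-- `F` is "the" form of degree `(1,0)` vanishing at all points of `ℙ^1 × ℙ^1` whose
first coordinate is `P`. -/
def IsForm1Of (P : Proj1 K) (F : R2 K) : Prop :=
  IsWeightedHomogeneous (wt 2 (fun _ => 1)) F (Pi.single 0 1) ∧ F ≠ 0 ∧
  ∀ x : Sig 2 (fun _ => 1) → K,
    (∃ c : K, (fun j : Fin 2 => x ⟨0, j⟩) = c • P.rep) → MvPolynomial.eval x F = 0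

/-- `F` is "the" form of degree `(0,1)` vanishing at all points of `ℙ^1 × ℙ^1` whose
second coordinate is `P`. -/
def IsForm2Of (P : Proj1 K) (F : R2 K) : Prop :=
  IsWeightedHomogeneous (wt 2 (fun _ => 1)) F (Pi.single 1 1) ∧ F ≠ 0 ∧
  ∀ x : Sig 2 (fun _ => 1) → K,
    (∃ c : K, (fun j : Fin 2 => x ⟨1, j⟩) = c • P.rep) → MvPolynomial.eval x F = 0

end PaperMP

namespace PaperMP

section RegularSequences

open CategoryTheory Abelian RingTheory.Sequence Pointwise

/-- If `gs` is weakly regular on `M` and `Ext^i(R/I, M)` vanishes for `i ≤ gs.length`, then `I`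
contains an element regular on `M/(gs)M`. -/
theorem exists_isSMulRegular_of_subsingleton_ext {R : Type} [CommRing R] [IsNoetherianRing R]
    (I : Ideal R) (gs : List R) (M : ModuleCat.{0} R) [Module.Finite R M]
    (hgs : IsWeaklyRegular M gs)
    (hext : ∀ i < gs.length + 1, Subsingleton (Ext (ModuleCat.of R (R ⧸ I)) M i)) :
    ∃ r ∈ I, IsSMulRegular (M ⧸ (Ideal.ofList gs • ⊤ : Submodule R M)) r := by
  induction gs generalizing M with
  | nil =>
    have h0 : Subsingleton ((R ⧸ I) →ₗ[R] M) :=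
      (Ext.addEquiv₀.trans ModuleCat.homAddEquiv).subsingleton_congr.mp (hext 0 (by simp))
    obtain ⟨r, hr, hreg⟩ := IsSMulRegular.subsingleton_linearMap_iff.mp h0
    rw [Ideal.annihilator_quotient] at hr
    refine ⟨r, hr, ?_⟩
    rw [isSMulRegular_quotient_iff_mem_of_smul_mem]
    simp only [Ideal.ofList_nil, Submodule.bot_smul, Submodule.mem_bot]
    exact isSMulRegular_iff_right_eq_zero_of_smul.mp hreg
  | cons g gs ih =>
    rw [isWeaklyRegular_cons_iff] at hgs
    obtain ⟨r, hr, hreg⟩ := ih (ModuleCat.of R (QuotSMulTop g M)) hgs.2 fun i hi => by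
      have zero1 := AddCommGrpCat.isZero_of_iff_subsingleton.mpr
        (hext i (by simp only [List.length_cons]; omega))
      have zero2 := AddCommGrpCat.isZero_of_iff_subsingleton.mpr
        (hext (i + 1) (by simp only [List.length_cons]; omega))
      exact AddCommGrpCat.subsingleton_of_isZero <| ShortComplex.Exact.isZero_of_both_zeros
        ((Ext.covariant_sequence_exact₃' _ hgs.1.smulShortComplex_shortExact) i (i + 1) rfl)
        (zero1.eq_zero_of_src _) (zero2.eq_zero_of_tgt _)
    exact ⟨r, hr, ((Submodule.quotOfListConsSMulTopEquivQuotSMulTopInner M g gs).isSMulRegular_congr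
      r).mpr hreg⟩

/-- A weakly regular sequence `gs` shorter than some regular sequence contained in `I` leaves a
regular element in `I`. -/
theorem exists_isSMulRegular_of_length_lt {R : Type} [CommRing R] [IsNoetherianRing R]
    (I : Ideal R) (M : Type) [AddCommGroup M] [Module R M] [Module.Finite R M]
    (hM : I • (⊤ : Submodule R M) < ⊤) {fs gs : List R} (hfs : IsRegular M fs)
    (hfI : ∀ f ∈ fs, f ∈ I) (hgs : IsWeaklyRegular M gs) (hlen : gs.length < fs.length) :
    ∃ r ∈ I, IsSMulRegular (M ⧸ (Ideal.ofList gs • ⊤ : Submodule R M)) r := by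
  refine exists_isSMulRegular_of_subsingleton_ext I gs (ModuleCat.of R M) hgs fun i hi => ?_
  refine ModuleCat.subsingleton_ext_of_exists_isRegular I _ ?_ (ModuleCat.of R M) hM fs hfI hfs
    i (by omega)
  exact (Module.support_eq_zeroLocus (R := R) (M := R ⧸ I)).trans
    (by rw [Ideal.annihilator_quotient]) |>.subset

theorem mk_mem_smul_top_iff {R : Type*} [CommRing R] (I J : Ideal R) (x : R) :
    Ideal.Quotient.mk I x ∈ (J • ⊤ : Submodule R (R ⧸ I)) ↔ x ∈ I ⊔ J := by
  rw [← Ideal.comap_map_quotientMk, Ideal.mem_comap]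
  simp [Ideal.smul_top_eq_map]

theorem isSMulRegular_quotient_smul_top_iff {R : Type*} [CommRing R] (I J : Ideal R) (r : R) :
    IsSMulRegular ((R ⧸ I) ⧸ (J • ⊤ : Submodule R (R ⧸ I))) r ↔
      ∀ x, r * x ∈ I ⊔ J → x ∈ I ⊔ J := by
  rw [isSMulRegular_quotient_iff_mem_of_smul_mem, Ideal.Quotient.mk_surjective.forall]
  refine forall_congr' fun x => ?_
  rw [← mk_mem_smul_top_iff, ← mk_mem_smul_top_iff, map_mul]
  rfl

end RegularSequences

section

variable {K : Type} [Field K] {k : ℕ} {n : Fin k → ℕ}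

theorem isWeaklyRegular_of_isRegSeqMod {I : Ideal (MPRing K k n)} {L : List (MPRing K k n)}
    (h : IsRegSeqMod K k n I L) :
    RingTheory.Sequence.IsWeaklyRegular (MPRing K k n ⧸ I) L := by
  rw [RingTheory.Sequence.isWeaklyRegular_iff_Fin]
  exact fun i => (isSMulRegular_quotient_smul_top_iff I _ _).mpr (h.2 i)

theorem mem_maxIdeal_iff {f : MPRing K k n} : f ∈ maxIdeal K k n ↔ eval 0 f = 0 := by
  have : (eval 0 : MPRing K k n →+* K) = constantCoeff := by ext <;> simp
  rw [this, maxIdeal, ← Set.image_univ, mem_ideal_span_X_image]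
  simp only [Set.mem_univ, true_and, constantCoeff_eq, ← notMem_support_iff]
  refine ⟨fun h h0 => ?_, fun h m hm => ?_⟩
  · obtain ⟨i, hi⟩ := h 0 h0
    exact hi rfl
  · by_contra! hc
    exact h (by rwa [show m = 0 from Finsupp.ext hc] at hm)

theorem maxIdeal_ne_top : maxIdeal K k n ≠ ⊤ := by
  rw [Ideal.ne_top_iff_one, mem_maxIdeal_iff]
  simp

/-- A regular sequence modulo `I` which cannot be extended because `maxIdeal` kills a nonzero
class has the largest possible length. -/
theorem hasDepth_of_isRegSeqMod {I : Ideal (MPRing K k n)} {L : List (MPRing K k n)}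
    (hL : IsRegSeqMod K k n I L) {u : MPRing K k n} (hu : u ∉ I ⊔ Ideal.span {f | f ∈ L})
    (hmu : ∀ r ∈ maxIdeal K k n, r * u ∈ I ⊔ Ideal.span {f | f ∈ L}) :
    hasDepth K k n I L.length := by
  refine ⟨⟨L, rfl, hL⟩, ?_⟩
  rintro _ ⟨F, rfl, hF⟩
  by_contra! hlt
  have hne : ∀ J : Ideal (MPRing K k n), I ⊔ J ≤ maxIdeal K k n →
      J • (⊤ : Submodule (MPRing K k n) (MPRing K k n ⧸ I)) ≠ ⊤ := by
    intro J hJ hT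
    have h1 : Ideal.Quotient.mk I 1 ∈
        (J • ⊤ : Submodule (MPRing K k n) (MPRing K k n ⧸ I)) := by
      rw [hT]
      exact Submodule.mem_top
    rw [mk_mem_smul_top_iff] at h1
    exact maxIdeal_ne_top ((Ideal.eq_top_iff_one _).mpr (hJ h1))
  obtain ⟨r, hr, hreg⟩ := exists_isSMulRegular_of_length_lt (maxIdeal K k n) (MPRing K k n ⧸ I)
    (hne _ (sup_le (le_sup_left.trans hL.1) le_rfl)).lt_top
    ⟨isWeaklyRegular_of_isRegSeqMod hF, (hne _ hF.1).symm⟩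
    (fun f hf => hF.1 (Ideal.mem_sup_right (Ideal.subset_span hf)))
    (isWeaklyRegular_of_isRegSeqMod hL) hlt
  exact hu ((isSMulRegular_quotient_smul_top_iff I _ _).mp hreg u (hmu r hr))

end

section VanishingIdeals

variable {K : Type} [Field K] {k : ℕ} {n : Fin k → ℕ}

theorem mem_vanishingIdeal_iff {T : Set (Sig k n → K)} {f : MPRing K k n} :
    f ∈ vanishingIdeal K k n T ↔ ∀ x ∈ T, eval x f = 0 := by
  simp [vanishingIdeal, RingHom.mem_ker]

theorem eval_eq_zero_of_line [Infinite K] {σ : Type*} {q : MvPolynomial σ K} {x v : σ → K}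
    (hq : ∀ c : K, c ≠ 0 → eval (x + c • v) q = 0) : eval x q = 0 := by
  let p : Polynomial K := aeval (fun s => Polynomial.C (x s) + Polynomial.C (v s) * Polynomial.X) q
  have hp (c : K) : p.eval c = eval (x + c • v) q := by
    change (Polynomial.evalRingHom c) (aeval _ q) = _
    rw [aeval_def, hom_eval₂, eval, coe_eval₂Hom]
    congr 1
    · ext; simp
    · ext s
      simp
      ring
  have h0 : p = 0 := by
    refine Polynomial.eq_zero_of_infinite_isRoot p
      ((Set.finite_singleton (0 : K)).infinite_compl.mono ?_)
    intro c hc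
    exact (hp c).trans (hq c hc)
  simpa [h0] using (hp 0).symm

/-- If through each point of `T` passes a line inside `T` along which `h` has slope one, then `h`
is a non-zero-divisor modulo the vanishing ideal of `T`. -/
theorem mem_vanishingIdeal_of_mul_mem [Infinite K] {T : Set (Sig k n → K)} {h G : MPRing K k n}
    (hT : ∀ x ∈ T, ∃ v : Sig k n → K, ∀ c : K,
      x + c • v ∈ T ∧ eval (x + c • v) h = eval x h + c)
    (hG : h * G ∈ vanishingIdeal K k n T) : G ∈ vanishingIdeal K k n T := by
  rw [mem_vanishingIdeal_iff] at hG ⊢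
  intro x hx
  by_cases h0 : eval x h = 0
  · obtain ⟨v, hv⟩ := hT x hx
    refine eval_eq_zero_of_line (v := v) fun c hc => ?_
    have := hG _ (hv c).1
    rw [map_mul, (hv c).2, h0, zero_add] at this
    exact (mul_eq_zero.mp this).resolve_left hc
  · have := hG x hx
    rw [map_mul] at this
    exact (mul_eq_zero.mp this).resolve_left h0

end VanishingIdeals

section CoordinatePoints

variable (K : Type) [Field K] {k : ℕ} {n : Fin k → ℕ}

/-- The point of multiprojective space whose `i`-th component is the coordinate point `a i`. -/
def coordPoint (a : ∀ i, Fin (n i + 1)) : MPPoint K k n := fun i =>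
  Projectivization.mk K (Pi.single (a i) 1) (by simp)

/-- The union of the cones over two coordinate points, cut by the vanishing of the first `t`
of the variables indexed by `a`. -/
def coneSection (a b : ∀ i, Fin (n i + 1)) (t : ℕ) : Set (Sig k n → K) :=
  {x | (x ∈ cone K k n (coordPoint K a) ∨ x ∈ cone K k n (coordPoint K b)) ∧
    ∀ i : Fin k, (i : ℕ) < t → x ⟨i, a i⟩ = 0}

variable {K} {a b : ∀ i, Fin (n i + 1)}

theorem mem_cone_coordPoint {x : Sig k n → K} :
    x ∈ cone K k n (coordPoint K a) ↔ ∀ i j, j ≠ a i → x ⟨i, j⟩ = 0 := by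
  refine forall_congr' fun i => ?_
  obtain ⟨u, hu⟩ := Projectivization.exists_smul_eq_mk_rep K
    (Pi.single (a i) 1 : Fin (n i + 1) → K) (by simp)
  change (∃ c : K, (fun j => x ⟨i, j⟩) = c • (Projectivization.mk K _ _).rep) ↔ _
  rw [← hu]
  constructor
  · rintro ⟨c, hc⟩ j hj
    simpa [hj] using congrFun hc j
  · intro h
    refine ⟨x ⟨i, a i⟩ * (u⁻¹ : Kˣ), funext fun j => ?_⟩
    by_cases hj : j = a i
    · subst hj
      simp [Units.smul_def]
    · simp [hj, h j hj]

theorem add_smul_single_mem_cone {x : Sig k n → K} (hx : x ∈ cone K k n (coordPoint K a))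
    (c : K) (i : Fin k) :
    x + c • Pi.single ⟨i, a i⟩ 1 ∈ cone K k n (coordPoint K a) := by
  rw [mem_cone_coordPoint] at hx ⊢
  intro i' j hj
  have : (⟨i', j⟩ : Sig k n) ≠ ⟨i, a i⟩ := by
    rintro h
    obtain ⟨rfl, h⟩ := Sigma.mk.inj_iff.mp h
    exact hj (eq_of_heq h)
  simp [hx i' j hj, this]

theorem idealOfSet_pair_coordPoint :
    idealOfSet K k n {coordPoint K a, coordPoint K b} =
      vanishingIdeal K k n (coneSection K a b 0) := by
  ext f
  simp only [idealOfSet, idealOfPoint, Ideal.mem_iInf, mem_vanishingIdeal_iff, coneSection,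
    Set.mem_insert_iff, Set.mem_singleton_iff, forall_eq, Set.mem_ofPred_eq,
    Nat.not_lt_zero, false_imp_iff, implies_true, and_true, or_imp, forall_and]

theorem vanishingIdeal_coneSection_zero_sup {t : ℕ} :
    vanishingIdeal K k n (coneSection K a b 0) ⊔
        Ideal.span {f | ∃ i : Fin k, (i : ℕ) < t ∧ X ⟨i, a i⟩ = f} =
      vanishingIdeal K k n (coneSection K a b t) := by
  refine le_antisymm (sup_le (fun f hf => ?_) (Ideal.span_le.mpr ?_)) fun f hf => ?_
  · rw [mem_vanishingIdeal_iff] at hf ⊢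
    exact fun x hx => hf x ⟨hx.1, by simp⟩
  · rintro _ ⟨i, hi, rfl⟩
    rw [SetLike.mem_coe, mem_vanishingIdeal_iff]
    exact fun x hx => by simpa using hx.2 i hi
  · classical
    set S := Ideal.span {f : MPRing K k n | ∃ i : Fin k, (i : ℕ) < t ∧ X ⟨i, a i⟩ = f}
    let φ : Sig k n → MPRing K k n := fun s => if (s.1 : ℕ) < t ∧ s.2 = a s.1 then 0 else X s
    have hφ : (Ideal.Quotient.mkₐ K S).comp (bind₁ φ) = Ideal.Quotient.mkₐ K S := by
      ext s
      by_cases hs : (s.1 : ℕ) < t ∧ s.2 = a s.1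
      · have : (X s : MPRing K k n) ∈ S := Ideal.subset_span ⟨s.1, hs.1, by rw [← hs.2]⟩
        simp [φ, hs, Ideal.Quotient.eq_zero_iff_mem.mpr this]
      · simp [φ, hs]
    have hsub : f - bind₁ φ f ∈ S := by
      rw [← Ideal.Quotient.eq]
      exact (DFunLike.congr_fun hφ f).symm
    rw [← add_sub_cancel (bind₁ φ f) f]
    refine Submodule.add_mem_sup ?_ hsub
    rw [mem_vanishingIdeal_iff] at hf ⊢
    intro x hx
    have hev : eval x (bind₁ φ f) = eval (fun s => eval x (φ s)) f := by
      rw [← coe_aeval_eq_eval, ← coe_aeval_eq_eval]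
      exact aeval_bind₁ _ _ _
    rw [hev]
    have hx0 (s : Sig k n) (h0 : x s = 0) : eval x (φ s) = 0 := by
      simp only [φ]; split_ifs <;> simp [h0]
    refine hf _ ⟨hx.1.imp ?_ ?_, fun i hi => by simp [φ, hi]⟩
    all_goals
      simp only [mem_cone_coordPoint]
      exact fun h i j hj => hx0 _ (h i j hj)

theorem add_smul_single_mem_coneSection_left {x : Sig k n → K} {t : ℕ} {i : Fin k} (hi : t ≤ i)
    (hx : x ∈ cone K k n (coordPoint K a)) (ht : ∀ i : Fin k, (i : ℕ) < t → x ⟨i, a i⟩ = 0)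
    (c : K) : x + c • Pi.single ⟨i, a i⟩ 1 ∈ coneSection K a b t := by
  refine ⟨Or.inl (add_smul_single_mem_cone hx c i), fun i' hi' => ?_⟩
  have : (⟨i', a i'⟩ : Sig k n) ≠ ⟨i, a i⟩ := by
    rintro h
    obtain ⟨rfl, -⟩ := Sigma.mk.inj_iff.mp h
    omega
  simp [ht i' hi', this]

theorem add_smul_single_mem_coneSection_right {x : Sig k n → K} {t : ℕ} {i : Fin k} (hi : t ≤ i)
    (hx : x ∈ cone K k n (coordPoint K b)) (ht : ∀ i : Fin k, (i : ℕ) < t → x ⟨i, a i⟩ = 0)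
    (c : K) : x + c • Pi.single ⟨i, b i⟩ 1 ∈ coneSection K a b t := by
  refine ⟨Or.inr (add_smul_single_mem_cone hx c i), fun i' hi' => ?_⟩
  have : (⟨i', a i'⟩ : Sig k n) ≠ ⟨i, b i⟩ := by
    rintro h
    obtain ⟨rfl, -⟩ := Sigma.mk.inj_iff.mp h
    omega
  simp [ht i' hi', this]

/-- Two coordinate points which agree exactly in the components before `o` span a ring of
depth `o + 1`. -/
theorem hasDepth_pair_coordPoint [Infinite K] (o : Fin k)
    (hab : ∀ i : Fin k, i < o → a i = b i) (hne : ∀ i : Fin k, o ≤ i → a i ≠ b i) :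
    hasDepth K k n (idealOfSet K k n {coordPoint K a, coordPoint K b}) (o + 1) := by
  classical
  have hneo : (⟨o, a o⟩ : Sig k n) ≠ ⟨o, b o⟩ := by simpa using hne o le_rfl
  set h : MPRing K k n := X ⟨o, a o⟩ + X ⟨o, b o⟩ with hh
  let g : ℕ → MPRing K k n := fun t =>
    if ht : t < (o : ℕ) then X ⟨⟨t, ht.trans o.2⟩, a ⟨t, ht.trans o.2⟩⟩ else h
  let L : List (MPRing K k n) := (List.range (o + 1)).map g
  have hlen : L.length = o + 1 := by simp [L]
  set I := idealOfSet K k n {coordPoint K a, coordPoint K b} with hI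
  have htake (t : ℕ) (ht : t ≤ o) : I ⊔ Ideal.span {f | f ∈ L.take t} =
      vanishingIdeal K k n (coneSection K a b t) := by
    rw [hI, idealOfSet_pair_coordPoint, ← vanishingIdeal_coneSection_zero_sup (t := t)]
    suffices {f | f ∈ L.take t} = {f | ∃ i : Fin k, (i : ℕ) < t ∧ X ⟨i, a i⟩ = f} by rw [this]
    ext f
    simp only [L, ← List.map_take, List.take_range, List.mem_map, List.mem_range,
      Set.mem_ofPred_eq]
    constructor
    · rintro ⟨i, hi, rfl⟩
      have hio : i < (o : ℕ) := by omega
      exact ⟨⟨i, hio.trans o.2⟩, by simp; omega, by simp [g, hio]⟩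
    · rintro ⟨i, hi, rfl⟩
      exact ⟨i, by omega, by simp [g, show (i : ℕ) < o by omega]⟩
  have hfull : I ⊔ Ideal.span {f | f ∈ L} =
      vanishingIdeal K k n (coneSection K a b o) ⊔ Ideal.span {h} := by
    have : {f | f ∈ L} = {f | f ∈ L.take o} ∪ {h} := by
      ext f
      simp [L, List.range_succ, g, or_comm]
    rw [this, Ideal.span_union, ← sup_assoc, htake o le_rfl]
  have hreg : IsRegSeqMod K k n I L := by
    refine ⟨?_, fun i G hG => ?_⟩
    · rw [hfull, sup_le_iff, Ideal.span_singleton_le_iff_mem, mem_maxIdeal_iff]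
      refine ⟨fun f hf => ?_, by simp [hh]⟩
      rw [mem_vanishingIdeal_iff] at hf
      rw [mem_maxIdeal_iff]
      exact hf 0 ⟨Or.inl (by simp [mem_cone_coordPoint]), by simp⟩
    · have hio : (i : ℕ) ≤ o := by have := i.2; omega
      rw [htake i hio] at hG ⊢
      refine mem_vanishingIdeal_of_mul_mem (fun x hx => ?_) hG
      obtain ⟨i', hi'⟩ : ∃ i' : Fin k, (i' : ℕ) = i := ⟨⟨i, by omega⟩, rfl⟩
      have hget : L.get i = g i' := by simp [L, hi']
      rw [hget]
      rw [← hi'] at hx hio ⊢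
      obtain ⟨hx | hx, ht⟩ := hx
      · refine ⟨Pi.single ⟨i', a i'⟩ 1, fun c =>
          ⟨add_smul_single_mem_coneSection_left le_rfl hx ht c, ?_⟩⟩
        rcases hio.lt_or_eq with hlt | heq
        · simp [g, hlt]
        · obtain rfl : i' = o := Fin.ext heq
          simp [g, hh, hneo.symm]
          ring
      · refine ⟨Pi.single ⟨i', b i'⟩ 1, fun c =>
          ⟨add_smul_single_mem_coneSection_right le_rfl hx ht c, ?_⟩⟩
        rcases hio.lt_or_eq with hlt | heq
        · simp [g, hlt, hab i' hlt]
        · obtain rfl : i' = o := Fin.ext heq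
          simp [g, hh, hneo]
          ring
  rw [← hlen]
  refine hasDepth_of_isRegSeqMod hreg (u := X ⟨o, a o⟩) ?_ ?_
  · rw [hfull, Submodule.mem_sup]
    rintro ⟨p, hp, q, hq, hpq⟩
    obtain ⟨v, rfl⟩ := Ideal.mem_span_singleton'.mp hq
    rw [mem_vanishingIdeal_iff] at hp
    have h0a : (0 : Sig k n → K) ∈ cone K k n (coordPoint K a) := by simp [mem_cone_coordPoint]
    have h0b : (0 : Sig k n → K) ∈ cone K k n (coordPoint K b) := by simp [mem_cone_coordPoint]
    have hva : eval 0 (v - 1) = 0 := by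
      refine eval_eq_zero_of_line (v := Pi.single ⟨o, a o⟩ 1) fun c hc => ?_
      have h1 := hp _ (add_smul_single_mem_coneSection_left (b := b) le_rfl h0a
        (by simp) c (i := o))
      have h2 := congrArg (eval (0 + c • Pi.single (⟨o, a o⟩ : Sig k n) (1 : K))) hpq
      rw [map_add, h1] at h2
      simp only [hh, map_mul, map_add, eval_X, zero_add, Pi.smul_apply, Pi.single_eq_same,
        Pi.single_eq_of_ne hneo.symm, smul_eq_mul, mul_one, mul_zero, add_zero] at h2
      rw [zero_add, map_sub, map_one, mul_right_cancel₀ hc (h2.trans (one_mul c).symm), sub_self]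
    have hvb : eval 0 v = 0 := by
      refine eval_eq_zero_of_line (v := Pi.single ⟨o, b o⟩ 1) fun c hc => ?_
      have h1 := hp _ (add_smul_single_mem_coneSection_right (a := a) le_rfl h0b
        (by simp) c (i := o))
      have h2 := congrArg (eval (0 + c • Pi.single (⟨o, b o⟩ : Sig k n) (1 : K))) hpq
      rw [map_add, h1] at h2
      simpa [hh, hneo, hc] using h2
    rw [map_sub, hvb, map_one] at hva
    simp at hva
  · rw [hfull]
    set J := vanishingIdeal K k n (coneSection K a b o) ⊔ Ideal.span {h}
    have hhJ : h ∈ J := Ideal.mem_sup_right (Ideal.mem_span_singleton_self h)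
    have hV {f : MPRing K k n} (hf : ∀ x ∈ coneSection K a b o, eval x f = 0) : f ∈ J :=
      Ideal.mem_sup_left (mem_vanishingIdeal_iff.mpr hf)
    have hX (s : Sig k n) : X s * X ⟨o, a o⟩ ∈ J := by
      obtain ⟨i, j⟩ := s
      by_cases hj : j = a i
      · subst hj
        rcases lt_or_ge i o with hi | hi
        · exact hV fun x hx => by simp [hx.2 i hi]
        · have h1 : X ⟨i, a i⟩ * X ⟨o, b o⟩ ∈ J := hV fun x hx => by
            rcases hx.1 with hx | hx
            · simp [mem_cone_coordPoint.mp hx o (b o) (hne o le_rfl).symm]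
            · simp [mem_cone_coordPoint.mp hx i (a i) (hne i hi)]
          rw [show X ⟨i, a i⟩ * X ⟨o, a o⟩ =
            X ⟨i, a i⟩ * h - X ⟨i, a i⟩ * (X ⟨o, b o⟩ : MPRing K k n) by rw [hh]; ring]
          exact J.sub_mem (J.mul_mem_left _ hhJ) h1
      · refine hV fun x hx => ?_
        rcases hx.1 with hx | hx
        · simp [mem_cone_coordPoint.mp hx i j hj]
        · simp [mem_cone_coordPoint.mp hx o (a o) (hne o le_rfl)]
    intro r hr
    induction hr using Submodule.span_induction with
    | mem _ hs => obtain ⟨s, rfl⟩ := hs; exact hX s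
    | zero => simp
    | add p q _ _ hp hq => rw [add_mul]; exact J.add_mem hp hq
    | smul c p _ hp => rw [smul_eq_mul, mul_assoc]; exact J.mul_mem_left c hp

end CoordinatePoints

/-- for every `1 ≤ l ≤ k` there is a set of points of
`ℙ^{n_1} × ⋯ × ℙ^{n_k}` with `depth R/I_X = l`; explicitly, the two-point set
`{P_1 × ⋯ × P_k, P_1 × ⋯ × P_{l-1} × Q_l × ⋯ × Q_k}` has depth `l`. -/
theorem statement_1 (K : Type) [Field K] [IsAlgClosed K] [CharZero K]
    (k : ℕ) (hk : 0 < k) (n : Fin k → ℕ) (hn : ∀ i, 0 < n i)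
    (l : ℕ) (hl1 : 1 ≤ l) (hlk : l ≤ k)
    (Ppt Qpt : MPPoint K k n)
    (hP : Ppt = fun i => Projectivization.mk K
      (fun j : Fin (n i + 1) => if (j : ℕ) = 0 then 1 else 0)
      (by intro h; have := congrFun h 0; simp at this))
    (hQ : Qpt = fun i => Projectivization.mk K
      (fun j : Fin (n i + 1) => if (j : ℕ) = 1 then 1 else 0)
      (by intro h; have := congrFun h ⟨1, by have := hn i; omega⟩; simp at this))
    (Y : MPPoint K k n)
    (hY : Y = fun i : Fin k => if (i : ℕ) + 1 < l then Ppt i else Qpt i) :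
    (∀ l' : ℕ, 1 ≤ l' → l' ≤ k →
      ∃ X : Set (MPPoint K k n), X.Finite ∧ hasDepth K k n (idealOfSet K k n X) l') ∧
    hasDepth K k n (idealOfSet K k n {Ppt, Y}) l := by
  have hcore (l' : ℕ) (h1 : 1 ≤ l') (h2 : l' ≤ k) : hasDepth K k n (idealOfSet K k n
      {Ppt, fun i : Fin k => if (i : ℕ) + 1 < l' then Ppt i else Qpt i}) l' := by
    obtain ⟨o, rfl⟩ := Nat.exists_eq_add_of_le' h1
    let q : ∀ i, Fin (n i + 1) := fun i => ⟨1, by have := hn i; omega⟩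
    have hP' : Ppt = coordPoint K fun _ => 0 := by
      rw [hP]
      funext i
      simp only [coordPoint]
      congr 1
      funext j
      simp only [Pi.single_apply, Fin.ext_iff, Fin.val_zero]
    have hQ' : Qpt = coordPoint K q := by
      rw [hQ]
      funext i
      simp only [coordPoint]
      congr 1
      funext j
      simp [Pi.single_apply, Fin.ext_iff, q]
    have hY' : (fun i : Fin k => if (i : ℕ) + 1 < o + 1 then Ppt i else Qpt i) =
        coordPoint K fun i => if (i : ℕ) < o then 0 else q i := by
      funext i
      by_cases hi : (i : ℕ) < o <;> simp [hP', hQ', coordPoint, hi]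
    rw [hY', hP']
    refine hasDepth_pair_coordPoint ⟨o, h2⟩ (fun i hi => ?_) fun i hi => ?_
    · simp [show (i : ℕ) < o from hi]
    · simp [show ¬(i : ℕ) < o from not_lt.mpr hi, q, Fin.ext_iff]
  refine ⟨fun l' h1 h2 => ⟨_, Set.toFinite _, hcore l' h1 h2⟩, ?_⟩
  rw [hY]
  exact hcore l hl1 hlk

end PaperMP
end
end

section
/- Let X ⊆ ℙ^{n_1} × ⋯ × ℙ^{n_k} be a finite set of distinct points, and suppose L_1,…,L_t, with t ≤ k and each L_i ∈ R homogeneous of degree e_i, give rise to a regular sequence in R/I_X. Then there exists a positive integer l such that (x_{1,0},…,x_{1,n_1},…,x_{t,0},…,x_{t,n_t})^l ⊆ (I_X, L_1,…,L_t). -/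
open MvPolynomial

noncomputable section

namespace PaperMP

/-- Nakayama step for permuting a regular sequence: if `a ∈ m` is regular modulo `I` and `b` is
regular modulo `(I, a)` up to an element of `1 + m`, then so is `b` modulo `I`. -/
lemma exists_smul_mem_of_sup_span {A : Type*} [CommRing A] [IsNoetherianRing A]
    {m I : Ideal A} {a b : A} (ham : a ∈ m) (ha : ∀ g, a * g ∈ I → g ∈ I)
    (hb : ∃ s, s - 1 ∈ m ∧ ∀ g, b * g ∈ I ⊔ Ideal.span {a} → s * g ∈ I ⊔ Ideal.span {a}) :
    ∃ s, s - 1 ∈ m ∧ ∀ g, b * g ∈ I → s * g ∈ I := by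
  obtain ⟨s, hs, hsg⟩ := hb
  let C : Ideal A := Submodule.comap (LinearMap.lsmul A A b) I
  have hC : ∀ g, g ∈ C ↔ b * g ∈ I := fun g => Iff.rfl
  have key : C ≤ I ⊔ m • C := by
    intro g hg
    have hsub := hsg g (Ideal.mem_sup_left ((hC g).1 hg))
    obtain ⟨i, hi, y, hy, hiy⟩ := Submodule.mem_sup.1 hsub
    obtain ⟨g', rfl⟩ := Ideal.mem_span_singleton'.1 hy
    have hg' : g' ∈ C := by
      refine (hC g').2 (ha _ ?_)
      have : a * (b * g') = s * (b * g) - b * i := by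
        linear_combination b * hiy
      rw [this]
      exact I.sub_mem (I.mul_mem_left _ ((hC g).1 hg)) (I.mul_mem_left _ hi)
    have : g = i + (a • g' - (s - 1) • g) := by
      simp only [smul_eq_mul]
      linear_combination -hiy
    rw [this]
    exact Submodule.add_mem_sup hi
      (Submodule.sub_mem _ (Submodule.smul_mem_smul ham hg') (Submodule.smul_mem_smul hs hg))
  obtain ⟨r, hr, hrC⟩ := Submodule.exists_sub_one_mem_and_smul_le_of_fg_of_le_sup
    (IsNoetherian.noetherian C) le_rfl key
  exact ⟨r, hr, fun g hg => hrC (Submodule.smul_mem_pointwise_smul g r C ((hC g).2 hg))⟩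

lemma span_mem_take_succ {A : Type*} [CommRing A] {l : List A} {j : ℕ} (hj : j < l.length) :
    Ideal.span {f | f ∈ l.take (j + 1)} = Ideal.span {f | f ∈ l.take j} ⊔ Ideal.span {l[j]} := by
  rw [← Ideal.span_union]
  congr 1
  ext f
  rw [List.take_succ_eq_append_getElem hj]
  simp only [Set.mem_ofPred_eq, List.mem_append, List.mem_singleton, Set.mem_union,
    Set.mem_singleton_iff]

lemma eval_zero_of_mem_maxIdeal {K : Type} [Field K]
    {k : ℕ} {n : Fin k → ℕ} {f : MPRing K k n} (hf : f ∈ maxIdeal K k n) :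
    eval 0 f = 0 := by
  have : maxIdeal K k n ≤ RingHom.ker (eval (0 : Sig k n → K)) := by
    rw [maxIdeal, Ideal.span_le]
    rintro _ ⟨p, rfl⟩
    simp [RingHom.mem_ker]
  exact this hf

/-- Every entry of a regular sequence modulo `I` is regular modulo `I`, locally at the origin. -/
lemma IsRegSeqMod.exists_mul_mem {K : Type} [Field K]
    {k : ℕ} {n : Fin k → ℕ} {I : Ideal (MPRing K k n)} {l : List (MPRing K k n)}
    (h : IsRegSeqMod K k n I l) (i : Fin l.length) :
    ∃ s, s - 1 ∈ maxIdeal K k n ∧ ∀ g, l[i] * g ∈ I → s * g ∈ I := by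
  have main : ∀ j ≤ (i : ℕ), ∃ s, s - 1 ∈ maxIdeal K k n ∧
      ∀ g, l[i] * g ∈ I ⊔ Ideal.span {f | f ∈ l.take j} →
        s * g ∈ I ⊔ Ideal.span {f | f ∈ l.take j} := by
    intro j hj
    induction hj using Nat.decreasingInduction with
    | self => exact ⟨1, by simp, fun g hg => by simpa using h.2 i g hg⟩
    | of_succ j hj ih =>
      have hjl : j < l.length := hj.trans i.2
      rw [span_mem_take_succ hjl, ← sup_assoc] at ih
      exact exists_smul_mem_of_sup_span
        (h.1 (Ideal.mem_sup_right (Ideal.subset_span (List.getElem_mem hjl))))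
        (fun g hg => h.2 ⟨j, hjl⟩ g hg) ih
  simpa using main 0 (Nat.zero_le _)

section Points

variable {K : Type} [Field K] {k : ℕ} {n : Fin k → ℕ}

lemma mem_idealOfPoint {P : MPPoint K k n} {f : MPRing K k n} :
    f ∈ idealOfPoint K k n P ↔ ∀ x ∈ cone K k n P, eval x f = 0 := by
  simp [idealOfPoint, vanishingIdeal, RingHom.mem_ker]

lemma mem_idealOfSet {X : Set (MPPoint K k n)} {f : MPRing K k n} :
    f ∈ idealOfSet K k n X ↔ ∀ P ∈ X, f ∈ idealOfPoint K k n P := by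
  simp [idealOfSet]

/-- The chosen representatives of the components of a point, as a point of affine space. -/
def affineRep (P : MPPoint K k n) : Sig k n → K := fun p => (P p.1).rep p.2

lemma mem_cone_iff {P : MPPoint K k n} {x : Sig k n → K} :
    x ∈ cone K k n P ↔ ∃ c : Fin k → K, x = fun p => c p.1 * affineRep P p := by
  constructor
  · intro h
    choose c hc using h
    exact ⟨c, funext fun p => congrFun (hc p.1) p.2⟩
  · rintro ⟨c, rfl⟩ i
    exact ⟨c i, rfl⟩

lemma smul_affineRep_mem_cone (P : MPPoint K k n) (c : K) :
    (c • affineRep P) ∈ cone K k n P :=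
  mem_cone_iff.2 ⟨fun _ => c, rfl⟩

lemma affineRep_mem_cone (P : MPPoint K k n) : affineRep P ∈ cone K k n P := by
  simpa using smul_affineRep_mem_cone P 1

/-- Scaling rule for multihomogeneous polynomials. -/
lemma eval_mul_of_isWeightedHomogeneous {f : MPRing K k n} {d : Fin k → ℕ}
    (hf : IsWeightedHomogeneous (wt k n) f d) (c : Fin k → K) (y : Sig k n → K) :
    eval (fun p => c p.1 * y p) f = (∏ i, c i ^ d i) * eval y f := by
  rw [eval_eq', eval_eq', Finset.mul_sum]
  refine Finset.sum_congr rfl fun e he => ?_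
  have hw := hf (mem_support_iff.1 he)
  have hd : ∀ i, d i = ∑ j, e ⟨i, j⟩ := by
    intro i
    rw [← hw, Finsupp.weight_apply, Finsupp.sum_fintype _ _ (by simp), Finset.sum_apply,
      Fintype.sum_sigma, Finset.sum_eq_single i]
    · simp [wt]
    · intro b _ hb
      simp [wt, Pi.single_eq_of_ne hb.symm]
    · simp
  have hc : ∏ p : Sig k n, c p.1 ^ e p = ∏ i, c i ^ d i := by
    rw [Fintype.prod_sigma]
    exact Finset.prod_congr rfl fun i _ => by
      rw [hd, ← Finset.prod_pow_eq_pow_sum]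
  simp only [mul_pow, Finset.prod_mul_distrib, hc]
  ring

lemma eval_mul_of_isWeightedHomogeneous_single {f : MPRing K k n} {i : Fin k}
    (hf : IsWeightedHomogeneous (wt k n) f (Pi.single i 1)) (c : Fin k → K) (y : Sig k n → K) :
    eval (fun p => c p.1 * y p) f = c i * eval y f := by
  rw [eval_mul_of_isWeightedHomogeneous hf, Finset.prod_eq_single i]
  · simp
  · intro b _ hb
    simp [Pi.single_eq_of_ne hb]
  · simp

/-- Distinct points are separated by a polynomial vanishing on one cone. -/
lemma exists_mem_idealOfPoint_eval_ne_zero {P Q : MPPoint K k n} (h : Q ≠ P) :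
    ∃ G ∈ idealOfPoint K k n Q, eval (affineRep P) G ≠ 0 := by
  obtain ⟨i, hi⟩ := Function.ne_iff.1 h
  by_contra! hG
  have hcross : ∀ a b, (Q i).rep a * (P i).rep b = (Q i).rep b * (P i).rep a := by
    intro a b
    have := hG (C ((Q i).rep a) * X ⟨i, b⟩ - C ((Q i).rep b) * X ⟨i, a⟩) (by
      rw [mem_idealOfPoint]
      intro x hx
      obtain ⟨c, rfl⟩ := mem_cone_iff.1 hx
      simp only [affineRep, map_sub, map_mul, eval_C, eval_X]
      ring)
    simpa [affineRep, sub_eq_zero] using this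
  obtain ⟨a, ha⟩ := Function.ne_iff.1 (Q i).rep_nonzero
  have ha' : (Q i).rep a ≠ 0 := ha
  apply hi
  rw [← (Q i).mk_rep, ← (P i).mk_rep, eq_comm, Projectivization.mk_eq_mk_iff']
  refine ⟨(P i).rep a / (Q i).rep a, funext fun b => ?_⟩
  simp only [Pi.smul_apply, smul_eq_mul]
  field_simp
  linear_combination -hcross a b

/-- Locally at the origin, membership in `I_P` of `s * G` forces `G` to vanish at the
representative of `P`. -/
lemma eval_affineRep_eq_zero_of_mul_mem [Infinite K] {P : MPPoint K k n} {s G : MPRing K k n}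
    (hs : s - 1 ∈ maxIdeal K k n) (h : s * G ∈ idealOfPoint K k n P) :
    eval (affineRep P) G = 0 := by
  let φ : MPRing K k n →ₐ[K] Polynomial K :=
    aeval fun p => Polynomial.C (affineRep P p) * Polynomial.X
  have hφ : ∀ (c : K) (f : MPRing K k n), (φ f).eval c = eval (c • affineRep P) f := by
    intro c f
    induction f using MvPolynomial.induction_on with
    | C a => simp [φ, Polynomial.algebraMap_eq]
    | add f g hf hg => rw [map_add, Polynomial.eval_add, hf, hg, map_add]
    | mul_X f p hf =>
      rw [map_mul, Polynomial.eval_mul, hf, map_mul, aeval_X]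
      rw [Polynomial.eval_mul, Polynomial.eval_C, Polynomial.eval_X, eval_X, Pi.smul_apply,
        smul_eq_mul, mul_comm c]
  have hzero : φ s * φ G = 0 := by
    rw [← map_mul]
    refine Polynomial.funext fun c => ?_
    rw [hφ, Polynomial.eval_zero]
    exact mem_idealOfPoint.1 h _ (smul_affineRep_mem_cone P c)
  have hs0 : φ s ≠ 0 := by
    intro h0
    have h1 := hφ 0 s
    have h2 := eval_zero_of_mem_maxIdeal hs
    rw [h0, zero_smul, Polynomial.eval_zero] at h1
    rw [map_sub, ← h1, map_one] at h2
    simp at h2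
  have hG := (mul_eq_zero.1 hzero).resolve_left hs0
  have := hφ 1 G
  rwa [hG, one_smul, Polynomial.eval_zero, eq_comm] at this

/-- A form of degree `e_i` that is regular modulo `I_X` locally at the origin does not vanish at
any point of `X`. -/
lemma eval_affineRep_ne_zero [Infinite K] {X : Set (MPPoint K k n)} (hX : X.Finite) {F s : MPRing K k n}
    {i : Fin k} (hF : IsWeightedHomogeneous (wt k n) F (Pi.single i 1))
    (hs : s - 1 ∈ maxIdeal K k n)
    (hreg : ∀ g, F * g ∈ idealOfSet K k n X → s * g ∈ idealOfSet K k n X)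
    {P : MPPoint K k n} (hP : P ∈ X) : eval (affineRep P) F ≠ 0 := by
  classical
  intro h0
  have hFP : F ∈ idealOfPoint K k n P := by
    rw [mem_idealOfPoint]
    intro x hx
    obtain ⟨c, rfl⟩ := mem_cone_iff.1 hx
    rw [eval_mul_of_isWeightedHomogeneous_single hF, h0, mul_zero]
  choose! G hGQ hGP using fun (Q : MPPoint K k n) (h : Q ≠ P) =>
    exists_mem_idealOfPoint_eval_ne_zero h
  let H : MPRing K k n := ∏ Q ∈ hX.toFinset.erase P, G Q
  have hH : F * H ∈ idealOfSet K k n X := by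
    rw [mem_idealOfSet]
    intro Q hQ
    by_cases hQP : Q = P
    · exact hQP ▸ Ideal.mul_mem_right _ _ hFP
    · exact Ideal.mul_mem_left _ _ (Ideal.mem_of_dvd _
        (Finset.dvd_prod_of_mem G (by simp [hQP, hQ])) (hGQ Q hQP))
  have hval := eval_affineRep_eq_zero_of_mul_mem hs (mem_idealOfSet.1 (hreg H hH) P hP)
  rw [map_prod, Finset.prod_eq_zero_iff] at hval
  obtain ⟨Q, hQ, hQ0⟩ := hval
  exact hGP Q (Finset.ne_of_mem_erase hQ) hQ0

/-- Modulo `I_P`, a form of degree `e_i` not vanishing at `P` generates all `x_{i,j}`. -/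
lemma X_mem_idealOfPoint_sup {P : MPPoint K k n} {F : MPRing K k n} {i : Fin k}
    (hF : IsWeightedHomogeneous (wt k n) F (Pi.single i 1)) (h : eval (affineRep P) F ≠ 0)
    (j : Fin (n i + 1)) :
    (X ⟨i, j⟩ : MPRing K k n) ∈ idealOfPoint K k n P ⊔ Ideal.span {F} := by
  set u := eval (affineRep P) F
  have hmem : (X ⟨i, j⟩ - C (u⁻¹ * affineRep P ⟨i, j⟩) * F : MPRing K k n) ∈
      idealOfPoint K k n P := by
    rw [mem_idealOfPoint]
    intro x hx
    obtain ⟨c, rfl⟩ := mem_cone_iff.1 hx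
    rw [map_sub, map_mul, eval_mul_of_isWeightedHomogeneous_single hF, eval_X, eval_C]
    change _ - _ * (_ * u) = 0
    field_simp
    ring
  rw [← sub_add_cancel (X ⟨i, j⟩ : MPRing K k n) (C (u⁻¹ * affineRep P ⟨i, j⟩) * F)]
  exact Submodule.add_mem_sup hmem (Ideal.mul_mem_left _ _ (Ideal.mem_span_singleton_self F))

lemma mem_radical_idealOfSet_sup {X : Set (MPPoint K k n)} (hX : X.Finite)
    {J : Ideal (MPRing K k n)} {f : MPRing K k n}
    (h : ∀ P ∈ X, f ∈ idealOfPoint K k n P ⊔ J) :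
    f ∈ (idealOfSet K k n X ⊔ J).radical := by
  rw [Ideal.radical_eq_sInf, Ideal.mem_sInf]
  rintro p ⟨hp, hprime⟩
  have hinf : hX.toFinset.inf (idealOfPoint K k n) ≤ p := by
    refine le_trans (fun g hg => mem_idealOfSet.2 fun P hP => ?_) (le_sup_left.trans hp)
    exact Finset.inf_le (f := idealOfPoint K k n) (hX.mem_toFinset.2 hP) hg
  obtain ⟨P, hP, hPp⟩ := hprime.inf_le'.1 hinf
  exact sup_le hPp (le_sup_right.trans hp) (h P (hX.mem_toFinset.1 hP))

end Points

/-- if `L_1,…,L_t` (`t ≤ k`, `deg L_i = e_i`) is a regular sequence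
modulo `I_X`, then some power of `(x_{1,0},…,x_{t,n_t})` lies in `(I_X, L_1,…,L_t)`. -/
theorem statement_2 (K : Type) [Field K] [IsAlgClosed K] [CharZero K]
    (k : ℕ) (n : Fin k → ℕ)
    (X : Set (MPPoint K k n)) (hX : X.Finite)
    (t : ℕ) (ht : t ≤ k) (L : Fin t → MPRing K k n)
    (hdeg : ∀ i : Fin t,
      MvPolynomial.IsWeightedHomogeneous (wt k n) (L i) (Pi.single (Fin.castLE ht i) 1))
    (hreg : IsRegSeqMod K k n (idealOfSet K k n X) (List.ofFn L)) :
    ∃ l : ℕ, 0 < l ∧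
      (Ideal.span {f : MPRing K k n | ∃ (i : Fin k) (j : Fin (n i + 1)),
          (i : ℕ) < t ∧ f = MvPolynomial.X ⟨i, j⟩}) ^ l ≤
        idealOfSet K k n X ⊔ Ideal.span (Set.range L) := by
  have hrad : Ideal.span {f : MPRing K k n | ∃ (i : Fin k) (j : Fin (n i + 1)),
      (i : ℕ) < t ∧ f = MvPolynomial.X ⟨i, j⟩} ≤
        (idealOfSet K k n X ⊔ Ideal.span (Set.range L)).radical := by
    rw [Ideal.span_le]
    rintro _ ⟨i, j, hi, rfl⟩
    refine mem_radical_idealOfSet_sup hX fun P hP => ?_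
    obtain ⟨s, hs, hsg⟩ := hreg.exists_mul_mem ⟨i, by simpa using hi⟩
    have hL : IsWeightedHomogeneous (wt k n) (L ⟨i, hi⟩) (Pi.single i 1) := hdeg ⟨i, hi⟩
    have hne := eval_affineRep_ne_zero hX hL hs (by simpa using hsg) hP
    have hspan : Ideal.span {L ⟨i, hi⟩} ≤ Ideal.span (Set.range L) :=
      Ideal.span_mono (Set.singleton_subset_iff.2 ⟨_, rfl⟩)
    exact sup_le_sup le_rfl hspan (X_mem_idealOfPoint_sup hL hne j)
  obtain ⟨l, hl⟩ := Ideal.exists_pow_le_of_le_radical_of_fg hrad (IsNoetherian.noetherian _)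
  exact ⟨l + 1, l.succ_pos, (Ideal.pow_le_pow_right l.le_succ).trans hl⟩

end PaperMP
end
end

section
/- Let X be an ACM set of distinct points in ℙ^{n_1} × ⋯ × ℙ^{n_k} with Hilbert function H_X. Then the first difference function ΔH_X, defined by ΔH_X(i_1,…,i_k) = Σ_{0 ≤ (l_1,…,l_k) ≤ (1,…,1)} (−1)^{l_1+⋯+l_k} H_X(i_1−l_1,…,i_k−l_k) (with H_X(j) = 0 whenever j has a negative coordinate), is the Hilbert function of some ℕ^k-graded artinian quotient of the ring S = 𝕜[x_{1,1},…,x_{1,n_1},…,x_{k,1},…,x_{k,n_k}] (graded by deg x_{i,j} = e_i). -/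
open MvPolynomial

noncomputable section

namespace PaperMP

section Depth

variable {R : Type*} [CommRing R]

/-- `x` is a non-zero-divisor modulo the ideal `J`. -/
def RegMod (J : Ideal R) (x : R) : Prop := ∀ g, x * g ∈ J → g ∈ J

/-- There is a sequence of length `r` in `m` that is regular modulo `J`. -/
def DepthAtLeast (m : Ideal R) : ℕ → Ideal R → Prop
  | 0, _ => True
  | r + 1, J => ∃ x ∈ m, RegMod J x ∧ DepthAtLeast m r (J ⊔ Ideal.span {x})

/-- `R ⧸ J` has no nonzero element killed by `m`. -/
def NoSocle (m J : Ideal R) : Prop := ∀ u, (∀ a ∈ m, a * u ∈ J) → u ∈ J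

lemma mem_sup_span_singleton_iff {J : Ideal R} {x u : R} :
    u ∈ J ⊔ Ideal.span {x} ↔ ∃ t, u - x * t ∈ J := by
  rw [Submodule.mem_sup]
  constructor
  · rintro ⟨y, hy, z, hz, rfl⟩
    obtain ⟨t, rfl⟩ := Ideal.mem_span_singleton'.1 hz
    exact ⟨t, by convert hy using 1; ring⟩
  · rintro ⟨t, ht⟩
    exact ⟨_, ht, x * t, Ideal.mul_mem_right _ _ (Ideal.mem_span_singleton_self x), by ring⟩

lemma DepthAtLeast.noSocle {m J : Ideal R} {r : ℕ} (h : DepthAtLeast m (r + 1) J) :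
    NoSocle m J := by
  obtain ⟨x, hx, hreg, -⟩ := h
  exact fun u hu => hreg u (hu x hx)

lemma NoSocle.exchange {m J : Ideal R} {x y : R} (hx : x ∈ m)
    (hxJ : RegMod J x) (hyJ : RegMod J y) (h : NoSocle m (J ⊔ Ideal.span {x})) :
    NoSocle m (J ⊔ Ideal.span {y}) := by
  intro u hu
  obtain ⟨v, hv⟩ := mem_sup_span_singleton_iff.1 (hu x hx)
  have hvJ : v ∈ J ⊔ Ideal.span {x} := by
    refine h v fun a ha => ?_
    obtain ⟨w, hw⟩ := mem_sup_span_singleton_iff.1 (hu a ha)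
    refine mem_sup_span_singleton_iff.2 ⟨w, hyJ _ ?_⟩
    have h1 := J.mul_mem_left a hv
    have h2 := J.mul_mem_left x hw
    convert J.sub_mem h2 h1 using 1
    ring
  obtain ⟨t, ht⟩ := mem_sup_span_singleton_iff.1 hvJ
  refine mem_sup_span_singleton_iff.2 ⟨t, hxJ _ ?_⟩
  convert J.add_mem hv (J.mul_mem_left y ht) using 1
  ring

lemma RegMod.sup_of_regMod_sup {J : Ideal R} {x z : R} (hx : RegMod J x)
    (hz : RegMod (J ⊔ Ideal.span {x}) z) : RegMod (J ⊔ Ideal.span {z}) x := by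
  intro g hg
  obtain ⟨h, hh⟩ := mem_sup_span_singleton_iff.1 hg
  have : h ∈ J ⊔ Ideal.span {x} := by
    refine hz _ (mem_sup_span_singleton_iff.2 ⟨g, ?_⟩)
    convert J.neg_mem hh using 1
    ring
  obtain ⟨t, ht⟩ := mem_sup_span_singleton_iff.1 this
  refine mem_sup_span_singleton_iff.2 ⟨t, hx _ ?_⟩
  convert J.add_mem hh (J.mul_mem_left z ht) using 1
  ring

lemma exists_eq_colon_of_mem_associatedPrimes [IsNoetherianRing R] {J P : Ideal R}
    (h : P ∈ associatedPrimes R (R ⧸ J)) : P.IsPrime ∧ ∃ v, ∀ a, a ∈ P ↔ a * v ∈ J := by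
  obtain ⟨hP, w, hw⟩ := isAssociatedPrime_iff.1 h
  obtain ⟨v, rfl⟩ := Ideal.Quotient.mk_surjective w
  refine ⟨hP, v, fun a => ?_⟩
  rw [hw, Submodule.mem_colon_singleton, Submodule.mem_bot, ← Ideal.Quotient.eq_zero_iff_mem,
    map_mul, Algebra.smul_def]
  rfl

lemma exists_mem_associatedPrimes_of_not_regMod [IsNoetherianRing R] {J : Ideal R} {x : R}
    (h : ¬ RegMod J x) : ∃ P ∈ associatedPrimes R (R ⧸ J), x ∈ P := by
  simp only [RegMod, not_forall] at h
  obtain ⟨g, hg, hgJ⟩ := h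
  have : x ∈ ⋃ p ∈ associatedPrimes R (R ⧸ J), (p : Set R) := by
    rw [biUnion_associatedPrimes_eq_zero_divisors]
    refine ⟨Ideal.Quotient.mk J g, by rwa [Ne, Ideal.Quotient.eq_zero_iff_mem], ?_⟩
    rw [Algebra.smul_def]
    change Ideal.Quotient.mk J x * Ideal.Quotient.mk J g = 0
    rwa [← map_mul, Ideal.Quotient.eq_zero_iff_mem]
  simpa using this

lemma exists_regMod_of_noSocle [IsNoetherianRing R] {m J J' : Ideal R}
    (h : NoSocle m J) (h' : NoSocle m J') : ∃ z ∈ m, RegMod J z ∧ RegMod J' z := by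
  have key : ∀ {I : Ideal R}, NoSocle m I → ∀ P ∈ associatedPrimes R (R ⧸ I), ¬ m ≤ P := by
    intro I hI P hP hle
    obtain ⟨hprime, v, hv⟩ := exists_eq_colon_of_mem_associatedPrimes hP
    refine hprime.ne_top ((Ideal.eq_top_iff_one _).2 ((hv 1).2 ?_))
    rw [one_mul]
    exact hI v fun a ha => (hv a).1 (hle ha)
  have hfin : (associatedPrimes R (R ⧸ J) ∪ associatedPrimes R (R ⧸ J')).Finite :=
    (associatedPrimes.finite R _).union (associatedPrimes.finite R _)
  have hnot : ¬ ((m : Set R) ⊆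
      ⋃ P ∈ associatedPrimes R (R ⧸ J) ∪ associatedPrimes R (R ⧸ J'), ((id P : Ideal R) : Set R)) := by
    rw [Ideal.subset_union_prime_finite hfin ⊥ ⊥]
    · rintro ⟨P, hP | hP, hle⟩
      exacts [key h P hP hle, key h' P hP hle]
    · rintro P (hP | hP) - -
      exacts [hP.isPrime, hP.isPrime]
  obtain ⟨z, hz, hzn⟩ := Set.not_subset.1 hnot
  refine ⟨z, hz, ?_, ?_⟩
  all_goals
    by_contra hcon
    obtain ⟨P, hP, hzP⟩ := exists_mem_associatedPrimes_of_not_regMod hcon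
    exact hzn (Set.mem_biUnion (by first | exact Or.inl hP | exact Or.inr hP) hzP)

lemma sup_span_singleton_comm (J : Ideal R) (x y : R) :
    J ⊔ Ideal.span {x} ⊔ Ideal.span {y} = J ⊔ Ideal.span {y} ⊔ Ideal.span {x} := by
  rw [sup_assoc, sup_assoc, sup_comm (Ideal.span {x})]

/-- Cutting by any regular element of `m` lowers the depth by at most one. -/
lemma DepthAtLeast.sup_span_singleton [IsNoetherianRing R] {m : Ideal R} (r : ℕ) :
    ∀ (J : Ideal R) (y : R), DepthAtLeast m (r + 1) J → y ∈ m → RegMod J y →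
      DepthAtLeast m r (J ⊔ Ideal.span {y}) := by
  induction r with
  | zero => exact fun _ _ _ _ _ => trivial
  | succ r ih =>
    rintro J y ⟨x, hx, hxJ, hdx⟩ hy hyJ
    have hsx := hdx.noSocle
    obtain ⟨z, hz, hzx, hzy⟩ := exists_regMod_of_noSocle hsx (hsx.exchange hx hxJ hyJ)
    have hdxz := ih _ z hdx hz hzx
    rw [sup_span_singleton_comm] at hdxz
    have hdzy := ih _ y ⟨x, hx, hxJ.sup_of_regMod_sup hzx, hdxz⟩ hy (hyJ.sup_of_regMod_sup hzy)
    rw [sup_span_singleton_comm] at hdzy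
    exact ⟨z, hz, hzy, hdzy⟩

lemma exists_prime_eq_colon [IsNoetherianRing R] {m J : Ideal R} [m.IsPrime] {u : R}
    (hu : ∀ a, a * u ∈ J → a ∈ m) : ∃ P : Ideal R, P.IsPrime ∧ P ≤ m ∧ (∀ a, a * u ∈ J → a ∈ P) ∧
      ∃ v, ∀ a, a ∈ P ↔ a * v ∈ J := by
  let w : R ⧸ J := Ideal.Quotient.mk J u
  let N : Submodule R (R ⧸ J) := Submodule.span R {w}
  have hann : ∀ a, a ∈ Module.annihilator R N ↔ a * u ∈ J := by
    intro a
    rw [← Ideal.Quotient.eq_zero_iff_mem (I := J), map_mul]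
    exact Submodule.mem_annihilator_span_singleton w a
  obtain ⟨P, hP, hPm⟩ := Ideal.exists_minimalPrimes_le
    (show Module.annihilator R N ≤ m from fun a ha => hu a ((hann a).1 ha))
  have hass := Module.associatedPrimes.minimalPrimes_annihilator_subset_associatedPrimes R N hP
  obtain ⟨hprime, v⟩ := exists_eq_colon_of_mem_associatedPrimes
    (associatedPrimes.subset_of_injective N.injective_subtype hass)
  exact ⟨P, hprime, hPm, fun a ha => hP.1.2 ((hann a).2 ha), v⟩

lemma exists_colon_le [IsNoetherianRing R] {m J P : Ideal R} [m.IsPrime] (hPm : P ≤ m) {v x : R}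
    (hv : ∀ a, a ∈ P ↔ a * v ∈ J) (hx : x ∈ m) (hxJ : RegMod J x) :
    ∃ u, (∀ a ∈ P, a * u ∈ J) ∧ ∀ a, a * u ∈ J ⊔ Ideal.span {x} → a ∈ m := by
  by_contra! hcon
  let N : Ideal R := J.colon (P : Set R)
  have hN : ∀ u, u ∈ N ↔ ∀ a ∈ P, a * u ∈ J := by
    intro u
    simp only [N, Submodule.mem_colon, smul_eq_mul, mul_comm u]
    rfl
  let A := Localization.AtPrime m
  let φ := algebraMap R A
  have hle : N.map φ ≤ J.map φ ⊔ (Ideal.span {φ x}) • N.map φ := by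
    rw [Ideal.map_le_iff_le_comap]
    intro u hu
    obtain ⟨s, hs, hsm⟩ := hcon u ((hN u).1 hu)
    obtain ⟨t, ht⟩ := mem_sup_span_singleton_iff.1 hs
    have htN : t ∈ N := by
      refine (hN t).2 fun a ha => hxJ _ ?_
      have h1 := J.mul_mem_left s ((hN u).1 hu a ha)
      convert J.sub_mem h1 (J.mul_mem_left a ht) using 1
      ring
    have hunit : IsUnit (φ s) := IsLocalization.map_units A (⟨s, hsm⟩ : m.primeCompl)
    rw [Ideal.mem_comap, ← Ideal.unit_mul_mem_iff_mem _ hunit, ← map_mul,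
      show s * u = (s * u - x * t) + x * t by ring, map_add, map_mul φ x]
    refine add_mem (Ideal.mem_sup_left (Ideal.mem_map_of_mem _ ht)) (Ideal.mem_sup_right ?_)
    exact Submodule.smul_mem_smul (Ideal.mem_span_singleton_self _) (Ideal.mem_map_of_mem _ htN)
  have hjac : Ideal.span {φ x} ≤ (⊥ : Ideal A).jacobson := by
    rw [IsLocalRing.jacobson_eq_maximalIdeal ⊥ bot_ne_top, Ideal.span_singleton_le_iff_mem]
    exact (IsLocalization.AtPrime.to_map_mem_maximal_iff A m x).2 hx
  have hle' := Submodule.le_of_le_smul_of_le_jacobson_bot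
    ((N.map φ).fg_of_isNoetherianRing) hjac hle
  have hvN : v ∈ N := (hN v).2 fun a ha => (hv a).1 ha
  obtain ⟨⟨⟨j, hj⟩, s⟩, hjs⟩ := (IsLocalization.mem_map_algebraMap_iff m.primeCompl A).1
    (hle' (Ideal.mem_map_of_mem φ hvN))
  rw [← map_mul, IsLocalization.eq_iff_exists m.primeCompl] at hjs
  obtain ⟨c, hc⟩ := hjs
  have : (c * s : R) * v ∈ J := by
    convert J.mul_mem_left (c : R) hj using 1
    rw [← hc]; ring
  exact (c * s : m.primeCompl).2 (hPm ((hv _).2 this))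

/-- The depth bounds from below the dimension at `m` of every associated prime. -/
lemma height_add_le_height_map [IsNoetherianRing R] {m P₀ : Ideal R} [m.IsPrime] [P₀.IsPrime]
    (r : ℕ) : ∀ (J P : Ideal R), DepthAtLeast m r J → P.IsPrime → P₀ ≤ P → P ≤ m →
      (∃ v, ∀ a, a ∈ P ↔ a * v ∈ J) →
      (P.map (Ideal.Quotient.mk P₀)).height + r ≤ (m.map (Ideal.Quotient.mk P₀)).height := by
  induction r with
  | zero =>
    intro J P _ _ _ hPm _
    simpa using Ideal.height_mono (Ideal.map_mono hPm)
  | succ r ih =>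
    rintro J P ⟨x, hx, hxJ, hd⟩ hP h0 hPm ⟨v, hv⟩
    obtain ⟨u, hPu, hu⟩ := exists_colon_le hPm hv hx hxJ
    obtain ⟨Q, hQ, hQm, hcol, w⟩ := exists_prime_eq_colon hu
    have hPQ : P ≤ Q := fun a ha => hcol a (Ideal.mem_sup_left (hPu a ha))
    have hxQ : x ∈ Q := hcol x (Ideal.mem_sup_right
      (Ideal.mul_mem_right _ _ (Ideal.mem_span_singleton_self x)))
    have hxP : x ∉ P := fun h => hP.ne_top ((Ideal.eq_top_iff_one _).2 ((hv 1).2 (by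
      simpa using hxJ _ ((hv x).1 h))))
    have hsurj : Function.Surjective (Ideal.Quotient.mk P₀) := Ideal.Quotient.mk_surjective
    have hker : RingHom.ker (Ideal.Quotient.mk P₀) = P₀ := Ideal.mk_ker
    have hP' := Ideal.map_isPrime_of_surjective hsurj (I := P) (by rwa [hker])
    have hQ' := Ideal.map_isPrime_of_surjective hsurj (I := Q) (by rw [hker]; exact h0.trans hPQ)
    have hlt : P.map (Ideal.Quotient.mk P₀) < Q.map (Ideal.Quotient.mk P₀) := by
      refine lt_of_le_of_ne (Ideal.map_mono hPQ) fun heq => hxP ?_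
      have hmem := Ideal.mem_map_of_mem (Ideal.Quotient.mk P₀) hxQ
      rw [← heq, ← Ideal.mem_comap, Ideal.comap_map_of_surjective' _ hsurj, hker,
        sup_eq_left.2 h0] at hmem
      exact hmem
    calc _ = (P.map (Ideal.Quotient.mk P₀)).height + 1 + r := by push_cast; ring
      _ ≤ (Q.map (Ideal.Quotient.mk P₀)).height + r := by
        gcongr; exact Ideal.height_add_one_le_of_lt_of_isPrime hlt
      _ ≤ _ := ih _ Q hd hQ (h0.trans hPQ) hQm w

/-- If `P ≤ m` is an associated prime of `J` and `m` is minimal over `P` together with the elements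
of `s`, then the depth of `R ⧸ J` in `m` is at most the number of elements of `s`. -/
lemma not_depthAtLeast_of_card_lt [IsNoetherianRing R] {m P J : Ideal R} [m.IsPrime]
    (hP : P.IsPrime) (hPm : P ≤ m) (hPJ : ∃ v, ∀ a, a ∈ P ↔ a * v ∈ J) {s : Finset R}
    (hsm : ∀ y ∈ s, y ∈ m)
    (hmin : ∀ Q : Ideal R, Q.IsPrime → P ≤ Q → (∀ y ∈ s, y ∈ Q) → Q ≤ m → m ≤ Q) {r : ℕ}
    (hr : s.card < r) : ¬ DepthAtLeast m r J := by
  intro hd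
  have h1 := height_add_le_height_map (P₀ := P) r J P hd hP le_rfl hPm hPJ
  have hsurj : Function.Surjective (Ideal.Quotient.mk P) := Ideal.Quotient.mk_surjective
  have hker : RingHom.ker (Ideal.Quotient.mk P) = P := Ideal.mk_ker
  have hm' := Ideal.map_isPrime_of_surjective hsurj (I := m) (by rwa [hker])
  classical
  have hmem : m.map (Ideal.Quotient.mk P) ∈
      (Ideal.span ((s.image (Ideal.Quotient.mk P) : Finset (R ⧸ P)) : Set (R ⧸ P))).minimalPrimes := by
    refine ⟨⟨hm', ?_⟩, ?_⟩
    · rw [Ideal.span_le]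
      intro y hy
      obtain ⟨z, hz, rfl⟩ := Finset.mem_image.1 (Finset.mem_coe.1 hy)
      exact Ideal.mem_map_of_mem _ (hsm z hz)
    · rintro Q ⟨hQ, hsQ⟩ hQm
      rw [Ideal.map_le_iff_le_comap]
      refine hmin _ (hQ.comap _) ?_ ?_ ?_
      · intro a ha
        rw [Ideal.mem_comap, Ideal.Quotient.eq_zero_iff_mem.2 ha]
        exact Q.zero_mem
      · intro y hy
        exact hsQ (Ideal.subset_span (Finset.mem_coe.2 (Finset.mem_image_of_mem _ hy)))
      · intro a ha
        have hmem := hQm ha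
        rw [← Ideal.mem_comap, Ideal.comap_map_of_surjective' _ hsurj, hker,
          sup_eq_left.2 hPm] at hmem
        exact hmem
  have h2 := Ideal.height_le_card_of_mem_minimalPrimes_span_finset hmem
  have h3 : (r : ℕ∞) ≤ s.card := le_trans (le_trans le_add_self h1)
    (h2.trans (by exact_mod_cast Finset.card_image_le))
  exact absurd (by exact_mod_cast h3) (not_le.2 hr)

end Depth


section Graded

variable {K : Type*} [Field K] {σ : Type*} {k : ℕ} {w : σ → (Fin k → ℕ)}

/-- `I` contains all weighted homogeneous components of its elements. -/
def IsGradedIdeal (w : σ → (Fin k → ℕ)) (I : Ideal (MvPolynomial σ K)) : Prop :=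
  ∀ f ∈ I, ∀ d, weightedHomogeneousComponent w d f ∈ I

lemma decompose_coe_eq_weightedHomogeneousComponent (f : MvPolynomial σ K) (d : Fin k → ℕ) :
    letI := weightedGradedAlgebra K w
    (DirectSum.decompose (weightedHomogeneousSubmodule K w) f d : MvPolynomial σ K) =
      weightedHomogeneousComponent w d f :=
  weightedDecomposition.decompose'_apply K w f d

lemma weightedHomogeneousComponent_mul_of_le {L f : MvPolynomial σ K} {e d : Fin k → ℕ}
    (hL : IsWeightedHomogeneous w L e) (h : e ≤ d) :
    weightedHomogeneousComponent w d (L * f) = L * weightedHomogeneousComponent w (d - e) f := by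
  let _ := weightedGradedAlgebra K w
  have := DirectSum.coe_decompose_mul_of_left_mem_of_le (weightedHomogeneousSubmodule K w)
    (a := L) (b := f) hL h
  rw [← decompose_coe_eq_weightedHomogeneousComponent,
    ← decompose_coe_eq_weightedHomogeneousComponent]
  exact this

lemma weightedHomogeneousComponent_mul_of_not_le {L f : MvPolynomial σ K} {e d : Fin k → ℕ}
    (hL : IsWeightedHomogeneous w L e) (h : ¬ e ≤ d) :
    weightedHomogeneousComponent w d (L * f) = 0 := by
  let _ := weightedGradedAlgebra K w
  have := DirectSum.coe_decompose_mul_of_left_mem_of_not_le (weightedHomogeneousSubmodule K w)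
    (a := L) (b := f) hL h
  rw [← decompose_coe_eq_weightedHomogeneousComponent]
  exact this

lemma mem_of_weightedHomogeneousComponent_mem {I : Ideal (MvPolynomial σ K)} {f : MvPolynomial σ K}
    (h : ∀ d, weightedHomogeneousComponent w d f ∈ I) : f ∈ I := by
  rw [← sum_weightedHomogeneousComponent w f]
  exact finsum_induction (· ∈ I) I.zero_mem (fun _ _ => I.add_mem) h

lemma IsGradedIdeal.sup_span_singleton {I : Ideal (MvPolynomial σ K)} (hI : IsGradedIdeal w I)
    {L : MvPolynomial σ K} {e : Fin k → ℕ} (hL : IsWeightedHomogeneous w L e) :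
    IsGradedIdeal w (I ⊔ Ideal.span {L}) := by
  intro f hf d
  obtain ⟨t, ht⟩ := mem_sup_span_singleton_iff.1 hf
  have h := hI _ ht d
  rw [map_sub] at h
  by_cases hed : e ≤ d
  · rw [weightedHomogeneousComponent_mul_of_le hL hed] at h
    exact mem_sup_span_singleton_iff.2 ⟨_, h⟩
  · rw [weightedHomogeneousComponent_mul_of_not_le hL hed, sub_zero] at h
    exact Ideal.mem_sup_left h

lemma IsGradedIdeal.regMod {I : Ideal (MvPolynomial σ K)} (hI : IsGradedIdeal w I)
    {L : MvPolynomial σ K} {e : Fin k → ℕ} (hL : IsWeightedHomogeneous w L e)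
    (h : ∀ d G, IsWeightedHomogeneous w G d → L * G ∈ I → G ∈ I) : RegMod I L := by
  intro G hG
  refine mem_of_weightedHomogeneousComponent_mem (w := w) fun d => ?_
  refine h d _ (weightedHomogeneousComponent_isWeightedHomogeneous d G) ?_
  have := hI _ hG (d + e)
  rwa [weightedHomogeneousComponent_mul_of_le hL le_add_self, add_tsub_cancel_right] at this

lemma weightedHomogeneousComponent_map {τ : Type*} {w' : τ → (Fin k → ℕ)}
    (π : MvPolynomial σ K →ₐ[K] MvPolynomial τ K)
    (hπ : ∀ f d, IsWeightedHomogeneous w f d → IsWeightedHomogeneous w' (π f) d)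
    (f : MvPolynomial σ K) (d : Fin k → ℕ) :
    weightedHomogeneousComponent w' d (π f) = π (weightedHomogeneousComponent w d f) := by
  classical
  induction f using MvPolynomial.induction_on' with
  | monomial u a =>
    have h := isWeightedHomogeneous_monomial w u a rfl
    rw [weightedHomogeneousComponent_of_mem (hπ _ _ h), weightedHomogeneousComponent_of_mem h]
    split_ifs <;> simp
  | add p q hp hq => simp only [map_add, hp, hq]

lemma isWeightedHomogeneous_aeval {τ : Type*} {w' : τ → (Fin k → ℕ)}
    (g : σ → MvPolynomial τ K) (hg : ∀ p, IsWeightedHomogeneous w' (g p) (w p))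
    {f : MvPolynomial σ K} {d : Fin k → ℕ} (hf : IsWeightedHomogeneous w f d) :
    IsWeightedHomogeneous w' (aeval g f) d := by
  rw [aeval_def, eval₂_eq]
  refine IsWeightedHomogeneous.sum _ _ _ fun u hu => ?_
  rw [← zero_add d]
  refine (isWeightedHomogeneous_C w' _).mul ?_
  rw [← hf (mem_support_iff.1 hu), Finsupp.weight_apply, Finsupp.sum]
  exact IsWeightedHomogeneous.prod _ _ _ fun p _ => (hg p).pow _

/-- The Hilbert function of `K[σ] ⧸ I` in multidegree `d`. -/
def hilbGen (w : σ → (Fin k → ℕ)) (I : Ideal (MvPolynomial σ K)) (d : Fin k → ℕ) : ℕ :=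
  Module.finrank K ((weightedHomogeneousSubmodule K w d).map
    (Ideal.Quotient.mkₐ K I).toLinearMap)

lemma finrank_map_add_finrank_inf_ker {V V' : Type*} [AddCommGroup V] [Module K V]
    [AddCommGroup V'] [Module K V'] (W : Submodule K V) [FiniteDimensional K W] (g : V →ₗ[K] V') :
    Module.finrank K (W.map g) + Module.finrank K (W ⊓ LinearMap.ker g : Submodule K V) =
      Module.finrank K W := by
  rw [← LinearMap.finrank_range_add_finrank_ker (g.domRestrict W), LinearMap.range_domRestrict,
    LinearMap.ker_domRestrict, ← Submodule.map_comap_subtype, Submodule.finrank_map_subtype_eq]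

lemma finiteDimensional_weightedHomogeneousSubmodule [Finite σ] (hw : ∀ p, ∃ i, w p i ≠ 0)
    (d : Fin k → ℕ) : FiniteDimensional K (weightedHomogeneousSubmodule K w d) := by
  classical
  have := Fintype.ofFinite σ
  have hfin : {u : σ →₀ ℕ | Finsupp.weight w u = d}.Finite := by
    refine (Set.finite_Iic (Finsupp.equivFunOnFinite.symm fun _ : σ => ∑ i, d i)).subset ?_
    intro u hu p
    obtain ⟨i, hi⟩ := hw p
    simp only [Finsupp.equivFunOnFinite_symm_apply_apply]
    have h1 : u p * w p i ≤ d i := by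
      rw [← show Finsupp.weight w u = d from hu, Finsupp.weight_apply,
        Finsupp.sum_fintype _ _ (by simp), Finset.sum_apply]
      exact Finset.single_le_sum (f := fun q => (u q • w q) i) (fun _ _ => Nat.zero_le _)
        (Finset.mem_univ p)
    have h2 : u p ≤ u p * w p i := Nat.le_mul_of_pos_right _ (Nat.pos_of_ne_zero hi)
    exact (h2.trans h1).trans (Finset.single_le_sum (fun _ _ => Nat.zero_le _) (Finset.mem_univ i))
  have := hfin.to_subtype
  rw [weightedHomogeneousSubmodule_eq_finsupp_supported]
  exact Module.Finite.of_basis (basisRestrictSupport K {u | Finsupp.weight w u = d})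

lemma hilbGen_sup_span_singleton_add [Finite σ] (hw : ∀ p, ∃ i, w p i ≠ 0)
    {I : Ideal (MvPolynomial σ K)} (hI : IsGradedIdeal w I) {L : MvPolynomial σ K}
    {e : Fin k → ℕ} (hL : IsWeightedHomogeneous w L e) (hreg : RegMod I L) (d : Fin k → ℕ) :
    hilbGen w (I ⊔ Ideal.span {L}) (d + e) + hilbGen w I d = hilbGen w I (d + e) := by
  have hfd := finiteDimensional_weightedHomogeneousSubmodule (K := K) hw (d + e)
  let g := (Ideal.Quotient.factorₐ K (le_sup_left : I ≤ I ⊔ Ideal.span {L})).toLinearMap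
  let q := (Ideal.Quotient.mkₐ K I).toLinearMap
  let μ : (MvPolynomial σ K ⧸ I) →ₗ[K] (MvPolynomial σ K ⧸ I) := LinearMap.mulLeft K (q L)
  have hμ : Function.Injective μ := by
    rw [← LinearMap.ker_eq_bot, LinearMap.ker_eq_bot']
    intro y hy
    obtain ⟨f, rfl⟩ := Ideal.Quotient.mk_surjective y
    change Ideal.Quotient.mk I L * Ideal.Quotient.mk I f = 0 at hy
    rw [← map_mul, Ideal.Quotient.eq_zero_iff_mem] at hy
    exact Ideal.Quotient.eq_zero_iff_mem.2 (hreg f hy)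
  have hmap : (weightedHomogeneousSubmodule K w (d + e)).map
      (Ideal.Quotient.mkₐ K (I ⊔ Ideal.span {L})).toLinearMap =
      ((weightedHomogeneousSubmodule K w (d + e)).map q).map g := by
    rw [← Submodule.map_comp]
    rfl
  have hker : ((weightedHomogeneousSubmodule K w (d + e)).map q ⊓ LinearMap.ker g) =
      ((weightedHomogeneousSubmodule K w d).map q).map μ := by
    ext y
    constructor
    · rintro ⟨⟨f, hf, rfl⟩, hy⟩
      have hfI : f ∈ I ⊔ Ideal.span {L} := Ideal.Quotient.eq_zero_iff_mem.1 hy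
      obtain ⟨t, ht⟩ := mem_sup_span_singleton_iff.1 hfI
      have h := hI _ ht (d + e)
      rw [map_sub, weightedHomogeneousComponent_eq_self hf,
        weightedHomogeneousComponent_mul_of_le hL le_add_self, add_tsub_cancel_right] at h
      refine ⟨_, ⟨_, weightedHomogeneousComponent_mem w t d, rfl⟩, ?_⟩
      change Ideal.Quotient.mk I L * Ideal.Quotient.mk I _ = Ideal.Quotient.mk I f
      rw [← map_mul]
      exact (Ideal.Quotient.eq.2 h).symm
    · rintro ⟨_, ⟨f, hf, rfl⟩, rfl⟩
      have : μ (q f) = q (L * f) := (map_mul (Ideal.Quotient.mk I) L f).symm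
      rw [this]
      refine ⟨⟨_, ?_, rfl⟩, ?_⟩
      · rw [add_comm d e]
        exact IsWeightedHomogeneous.mul hL hf
      · exact Ideal.Quotient.eq_zero_iff_mem.2 (Ideal.mem_sup_right
          (Ideal.mul_mem_right _ _ (Ideal.mem_span_singleton_self L)))
  have h := finrank_map_add_finrank_inf_ker
    ((weightedHomogeneousSubmodule K w (d + e)).map q) g
  rw [hker, ← hmap, (Submodule.equivMapOfInjective μ hμ _).symm.finrank_eq] at h
  exact h

lemma hilbGen_sup_span_singleton_of_not_le [Finite σ] (hw : ∀ p, ∃ i, w p i ≠ 0)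
    {I : Ideal (MvPolynomial σ K)} (hI : IsGradedIdeal w I) {L : MvPolynomial σ K}
    {e : Fin k → ℕ} (hL : IsWeightedHomogeneous w L e) {d : Fin k → ℕ} (hed : ¬ e ≤ d) :
    hilbGen w (I ⊔ Ideal.span {L}) d = hilbGen w I d := by
  have hfd := finiteDimensional_weightedHomogeneousSubmodule (K := K) hw d
  have key : ∀ f ∈ weightedHomogeneousSubmodule K w d, f ∈ I ⊔ Ideal.span {L} ↔ f ∈ I := by
    refine fun f hf => ⟨fun h => ?_, fun h => Ideal.mem_sup_left h⟩
    obtain ⟨t, ht⟩ := mem_sup_span_singleton_iff.1 h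
    have h := hI _ ht d
    rwa [map_sub, weightedHomogeneousComponent_eq_self hf,
      weightedHomogeneousComponent_mul_of_not_le hL hed, sub_zero] at h
  have h1 := finrank_map_add_finrank_inf_ker (weightedHomogeneousSubmodule K w d)
    (Ideal.Quotient.mkₐ K I).toLinearMap
  have h2 := finrank_map_add_finrank_inf_ker (weightedHomogeneousSubmodule K w d)
    (Ideal.Quotient.mkₐ K (I ⊔ Ideal.span {L})).toLinearMap
  have h3 : weightedHomogeneousSubmodule K w d ⊓
        LinearMap.ker (Ideal.Quotient.mkₐ K (I ⊔ Ideal.span {L})).toLinearMap =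
      weightedHomogeneousSubmodule K w d ⊓ LinearMap.ker (Ideal.Quotient.mkₐ K I).toLinearMap := by
    ext f
    refine and_congr_right fun hf => ?_
    exact (Ideal.Quotient.eq_zero_iff_mem.trans (key f hf)).trans
      Ideal.Quotient.eq_zero_iff_mem.symm
  rw [h3] at h2
  exact Nat.add_right_cancel (h2.trans h1.symm)

/-- The Hilbert function is invariant under quotienting along a graded surjection. -/
lemma hilbGen_map {τ : Type*} {w' : τ → (Fin k → ℕ)} (π : MvPolynomial σ K →ₐ[K] MvPolynomial τ K)
    {I : Ideal (MvPolynomial σ K)} (hker : RingHom.ker π ≤ I) (hsurj : Function.Surjective π)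
    (hπ : ∀ d, (weightedHomogeneousSubmodule K w d).map π.toLinearMap =
      weightedHomogeneousSubmodule K w' d) (d : Fin k → ℕ) :
    hilbGen w' (I.map π) d = hilbGen w I d := by
  have hcomap : I = (I.map π).comap π := by
    rw [Ideal.comap_map_of_surjective' π hsurj, sup_eq_left.2 hker]
  let φ := (Ideal.quotientMapₐ (I.map π) π hcomap.le).toLinearMap
  have hφ : Function.Injective φ := by
    rw [← LinearMap.ker_eq_bot, LinearMap.ker_eq_bot']
    intro y hy
    obtain ⟨f, rfl⟩ := Ideal.Quotient.mk_surjective y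
    have hf : π f ∈ I.map π := Ideal.Quotient.eq_zero_iff_mem.1 hy
    exact Ideal.Quotient.eq_zero_iff_mem.2 (hcomap.ge hf)
  have hmap : (weightedHomogeneousSubmodule K w' d).map
      (Ideal.Quotient.mkₐ K (I.map π)).toLinearMap =
      ((weightedHomogeneousSubmodule K w d).map (Ideal.Quotient.mkₐ K I).toLinearMap).map φ := by
    rw [← hπ, ← Submodule.map_comp, ← Submodule.map_comp]
    rfl
  rw [hilbGen, hmap]
  exact (Submodule.equivMapOfInjective φ hφ _).symm.finrank_eq

end Graded


section Difference

variable {K : Type*} [Field K] {σ : Type*} {k : ℕ} {w : σ → (Fin k → ℕ)}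

lemma extNeg_natCast (H : (Fin k → ℕ) → ℕ) (d : Fin k → ℕ) :
    extNeg k H (fun i => (d i : ℤ)) = H d := by
  simp [extNeg]

lemma extNeg_of_neg (H : (Fin k → ℕ) → ℕ) {z : Fin k → ℤ} {i : Fin k} (h : z i < 0) :
    extNeg k H z = 0 :=
  if_neg fun h' => absurd (h' i) (not_le.2 h)

/-- Killing a form of degree `e_i` that is regular modulo `I` differences the Hilbert function
in the `i`-th direction. -/
lemma extNeg_hilbGen_sup_span_singleton [Finite σ] (hw : ∀ p, ∃ i, w p i ≠ 0)
    {I : Ideal (MvPolynomial σ K)} (hI : IsGradedIdeal w I) {L : MvPolynomial σ K} {i : Fin k}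
    (hL : IsWeightedHomogeneous w L (Pi.single i 1)) (hreg : RegMod I L) (z : Fin k → ℤ) :
    extNeg k (hilbGen w (I ⊔ Ideal.span {L})) z =
      extNeg k (hilbGen w I) z - extNeg k (hilbGen w I) (z - Pi.single i 1) := by
  by_cases hz : ∀ j, 0 ≤ z j
  · obtain ⟨d, rfl⟩ : ∃ d : Fin k → ℕ, z = fun j => (d j : ℤ) :=
      ⟨fun j => (z j).toNat, funext fun j => (Int.toNat_of_nonneg (hz j)).symm⟩
    by_cases hd : (Pi.single i 1 : Fin k → ℕ) ≤ d
    · obtain ⟨c, rfl⟩ : ∃ c : Fin k → ℕ, d = c + Pi.single i 1 :=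
         ⟨_, (tsub_add_cancel_of_le hd).symm⟩
      have hc : (fun j => ((c + Pi.single i 1 : Fin k → ℕ) j : ℤ)) - Pi.single i 1 =
          fun j => (c j : ℤ) := by
        funext j
        by_cases hj : j = i
        · subst hj; simp
        · simp [hj]
      rw [hc, extNeg_natCast, extNeg_natCast, extNeg_natCast,
        ← hilbGen_sup_span_singleton_add hw hI hL hreg c]
      push_cast
      ring
    · have hi : d i = 0 := by
        by_contra h
        refine hd fun j => ?_
        by_cases hj : j = i
        · subst hj
          simpa [Nat.one_le_iff_ne_zero] using h
        · simp [hj]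
      have hneg : ((fun j => (d j : ℤ)) - Pi.single i 1 : Fin k → ℤ) i < 0 := by simp [hi]
      rw [extNeg_of_neg _ hneg, extNeg_natCast, extNeg_natCast, sub_zero,
        hilbGen_sup_span_singleton_of_not_le hw hI hL hd]
  · push Not at hz
    obtain ⟨j, hj⟩ := hz
    have hj' : (z - Pi.single i 1 : Fin k → ℤ) j < 0 := by
      rw [Pi.sub_apply]
      have : (0 : ℤ) ≤ (Pi.single i 1 : Fin k → ℤ) j := by
        rw [Pi.single_apply]; split_ifs <;> simp
      omega
    rw [extNeg_of_neg _ hj, extNeg_of_neg _ hj, extNeg_of_neg _ hj', sub_zero]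

lemma sup_span_image_insert {R ι : Type*} [CommRing R] [DecidableEq ι] (I : Ideal R) (L : ι → R)
    (i : ι) (T : Finset ι) :
    I ⊔ Ideal.span (L '' (insert i T : Finset ι)) =
      I ⊔ Ideal.span (L '' T) ⊔ Ideal.span {L i} := by
  rw [Finset.coe_insert, Set.image_insert_eq, Ideal.span_insert, sup_comm (Ideal.span {L i}),
    sup_assoc]

lemma IsGradedIdeal.sup_span_image {I : Ideal (MvPolynomial σ K)} (hI : IsGradedIdeal w I)
    {L : Fin k → MvPolynomial σ K} (hL : ∀ i, IsWeightedHomogeneous w (L i) (Pi.single i 1))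
    (T : Finset (Fin k)) : IsGradedIdeal w (I ⊔ Ideal.span (L '' T)) := by
  classical
  induction T using Finset.induction_on with
  | empty => simpa using hI
  | insert i T _ ih =>
    rw [sup_span_image_insert]
    exact ih.sup_span_singleton (hL i)

lemma extNeg_hilbGen_sup_span_image [Finite σ] (hw : ∀ p, ∃ i, w p i ≠ 0)
    {I : Ideal (MvPolynomial σ K)} (hI : IsGradedIdeal w I) {L : Fin k → MvPolynomial σ K}
    (hL : ∀ i, IsWeightedHomogeneous w (L i) (Pi.single i 1))
    (hreg : ∀ T : Finset (Fin k), ∀ i ∉ T, RegMod (I ⊔ Ideal.span (L '' T)) (L i))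
    (T : Finset (Fin k)) (z : Fin k → ℤ) :
    extNeg k (hilbGen w (I ⊔ Ideal.span (L '' T))) z =
      ∑ U ∈ T.powerset, (-1) ^ U.card *
        extNeg k (hilbGen w I) (z - fun j => if j ∈ U then 1 else 0) := by
  classical
  induction T using Finset.induction_on generalizing z with
  | empty => simp [← Pi.zero_def]
  | insert i T hi ih =>
    rw [sup_span_image_insert, extNeg_hilbGen_sup_span_singleton hw (hI.sup_span_image hL T)
      (hL i) (hreg T i hi), Finset.sum_powerset_insert hi, ih, ih, sub_eq_add_neg,
      ← Finset.sum_neg_distrib]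
    congr 1
    refine Finset.sum_congr rfl fun U hU => ?_
    have hiU : i ∉ U := fun h => hi (Finset.mem_powerset.1 hU h)
    have hz : z - Pi.single i 1 - (fun j => if j ∈ U then (1 : ℤ) else 0) =
        z - fun j => if j ∈ insert i U then 1 else 0 := by
      funext j
      by_cases hj : j = i
      · subst hj; simp [hiU]
      · simp [hj]
    rw [hz, Finset.card_insert_of_notMem hiU, pow_succ]
    ring

lemma delta_eq_sum_powerset (H : (Fin k → ℕ) → ℕ) (d : Fin k → ℕ) :
    delta k H d = ∑ U ∈ (Finset.univ : Finset (Fin k)).powerset, (-1) ^ U.card *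
      extNeg k H ((fun j => (d j : ℤ)) - fun j => if j ∈ U then 1 else 0) := by
  classical
  have key : ∀ (l : Fin k → Fin 2) (j : Fin k), (l j : ℕ) = if l j = 1 then 1 else 0 := by
    intro l j
    generalize l j = x
    fin_cases x <;> rfl
  refine Finset.sum_bij' (fun l _ => Finset.univ.filter fun j => l j = 1)
    (fun U _ j => if j ∈ U then 1 else 0) (by simp) (by simp) ?_ (by simp) ?_
  · intro l _
    funext j
    simp only [Finset.mem_filter, Finset.mem_univ, true_and]
    generalize l j = x
    fin_cases x <;> rfl
  · intro l _
    have h1 : ∑ j, (l j : ℕ) = (Finset.univ.filter fun j => l j = 1).card := by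
      rw [Finset.card_filter]
      exact Finset.sum_congr rfl fun j _ => key l j
    have h2 : (fun j => (d j : ℤ) - (l j : ℕ)) = (fun j => (d j : ℤ)) -
        fun j => if j ∈ Finset.univ.filter fun j => l j = 1 then 1 else 0 := by
      funext j
      simp [key l j]
    rw [h1, h2]

end Difference


section Regular

variable {K : Type*} [Field K] {σ : Type*} {k : ℕ} {w : σ → (Fin k → ℕ)}

lemma idealOfVars_eq_ker_constantCoeff :
    idealOfVars σ K = RingHom.ker (constantCoeff : MvPolynomial σ K →+* K) := by
  ext f
  have := mem_pow_idealOfVars_iff (σ := σ) (R := K) 1 f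
  rw [pow_one] at this
  rw [this, RingHom.mem_ker, constantCoeff_eq]
  constructor
  · intro h
    by_contra h0
    have := h 0 (mem_support_iff.2 h0)
    simp at this
  · intro h u hu
    by_contra hc
    have : u = 0 := by
      rw [← Finsupp.degree_eq_zero_iff]
      omega
    subst this
    exact mem_support_iff.1 hu h

instance isPrime_idealOfVars : (idealOfVars σ K).IsPrime := by
  rw [idealOfVars_eq_ker_constantCoeff]
  exact RingHom.ker_isPrime _

lemma IsGradedIdeal.mem_idealOfVars_of_mul_mem (hw : ∀ p, w p ≠ 0)
    {J : Ideal (MvPolynomial σ K)} (hJ : IsGradedIdeal w J) {G : MvPolynomial σ K}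
    {d : Fin k → ℕ} (hG : IsWeightedHomogeneous w G d) (hGJ : G ∉ J) {a : MvPolynomial σ K}
    (ha : a * G ∈ J) : a ∈ idealOfVars σ K := by
  rw [idealOfVars_eq_ker_constantCoeff, RingHom.mem_ker, constantCoeff_eq]
  by_contra h0
  have h := hJ _ ha d
  rw [mul_comm, weightedHomogeneousComponent_mul_of_le hG le_rfl, tsub_self,
    weightedHomogeneousComponent_zero _ hw] at h
  have h' := J.mul_mem_left (C (coeff 0 a)⁻¹) h
  rw [mul_left_comm, ← C_mul, inv_mul_cancel₀ h0, C_1, mul_one] at h'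
  exact hGJ h'

section

variable [Finite σ] {I : Ideal (MvPolynomial σ K)} {L : Fin k → MvPolynomial σ K}

/-- A form `L i` is regular modulo `I` and other forms if the depth is large enough and the forms
cut `I` down to the irrelevant ideal. -/
lemma regMod_of_depthAtLeast (hw : ∀ p, w p ≠ 0) (hI : IsGradedIdeal w I)
    (hL : ∀ i, IsWeightedHomogeneous w (L i) (Pi.single i 1)) (hLm : ∀ i, L i ∈ idealOfVars σ K)
    (hmin : ∀ Q : Ideal (MvPolynomial σ K), Q.IsPrime → I ≤ Q → (∀ i, L i ∈ Q) →
      idealOfVars σ K ≤ Q) {T : Finset (Fin k)} {i : Fin k} (hi : i ∉ T)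
    (hd : DepthAtLeast (idealOfVars σ K) (k - T.card) (I ⊔ Ideal.span (L '' T))) :
    RegMod (I ⊔ Ideal.span (L '' T)) (L i) := by
  classical
  have hJ := hI.sup_span_image hL T
  refine hJ.regMod (hL i) fun d G hG hLG => ?_
  by_contra hGJ
  obtain ⟨P, hP, hPm, hcolon, hPJ⟩ := exists_prime_eq_colon
    (fun a ha => hJ.mem_idealOfVars_of_mul_mem hw hG hGJ ha)
  refine not_depthAtLeast_of_card_lt hP hPm hPJ
    (s := (insert i T)ᶜ.image L) ?_ ?_ ?_ hd
  · simp only [Finset.mem_image]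
    rintro _ ⟨j, _, rfl⟩
    exact hLm j
  · intro Q hQ hPQ hs _
    have hJP : I ⊔ Ideal.span (L '' T) ≤ P := by
      obtain ⟨v, hv⟩ := hPJ
      exact fun a ha => (hv a).2 (Ideal.mul_mem_right _ _ ha)
    refine hmin Q hQ (le_sup_left.trans (hJP.trans hPQ)) fun j => ?_
    by_cases hjT : j ∈ T
    · exact hPQ (hJP (Ideal.mem_sup_right (Ideal.subset_span ⟨j, hjT, rfl⟩)))
    by_cases hji : j = i
    · subst hji
      exact hPQ (hcolon _ hLG)
    · exact hs _ (Finset.mem_image_of_mem _ (by simp [hjT, hji]))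
  · have h1 : ((insert i T)ᶜ.image L).card ≤ (insert i T)ᶜ.card := Finset.card_image_le
    have h2 : (insert i T).card ≤ k := by simpa using Finset.card_le_univ (insert i T)
    rw [Finset.card_compl, Fintype.card_fin] at h1
    rw [Finset.card_insert_of_notMem hi] at h1 h2
    omega

lemma regMod_sup_span_image (hw : ∀ p, w p ≠ 0) (hI : IsGradedIdeal w I)
    (hL : ∀ i, IsWeightedHomogeneous w (L i) (Pi.single i 1)) (hLm : ∀ i, L i ∈ idealOfVars σ K)
    (hmin : ∀ Q : Ideal (MvPolynomial σ K), Q.IsPrime → I ≤ Q → (∀ i, L i ∈ Q) →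
      idealOfVars σ K ≤ Q) (hdepth : DepthAtLeast (idealOfVars σ K) k I)
    (T : Finset (Fin k)) (i : Fin k) (hi : i ∉ T) :
    RegMod (I ⊔ Ideal.span (L '' T)) (L i) := by
  classical
  refine regMod_of_depthAtLeast hw hI hL hLm hmin hi ?_
  clear hi i
  induction T using Finset.induction_on with
  | empty => simpa using hdepth
  | insert i T hi ih =>
    rw [sup_span_image_insert]
    have hcard : k - T.card = k - (insert i T).card + 1 := by
      have h2 : (insert i T).card ≤ k := by simpa using Finset.card_le_univ (insert i T)
      rw [Finset.card_insert_of_notMem hi] at h2 ⊢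
      omega
    refine DepthAtLeast.sup_span_singleton _ _ _ (hcard ▸ ih) (hLm i) ?_
    exact regMod_of_depthAtLeast hw hI hL hLm hmin hi ih

end

end Regular


lemma depthAtLeast_length {R : Type*} [CommRing R] {m : Ideal R} (L : List R) :
    ∀ I : Ideal R, (∀ x ∈ L, x ∈ m) →
      (∀ i : Fin L.length, RegMod (I ⊔ Ideal.span {f | f ∈ L.take i}) (L.get i)) →
      DepthAtLeast m L.length I := by
  induction L with
  | nil => exact fun _ _ _ => trivial
  | cons x L ih =>
    intro I hm hreg
    refine ⟨x, hm x (by simp), by simpa using hreg 0, ih _ (fun y hy => hm y (by simp [hy])) ?_⟩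
    intro i
    have h := hreg i.succ
    have hset : {f | f ∈ (x :: L).take (i.succ : Fin (x :: L).length)} =
        insert x {f | f ∈ L.take i} := by
      ext f
      simp
    rw [hset, Ideal.span_insert, ← sup_assoc] at h
    exact h

section Geometry

variable {K : Type} [Field K] {k : ℕ} {n : Fin k → ℕ}

lemma wt_ne_zero (p : Sig k n) : wt k n p ≠ 0 := by
  simp [wt]

lemma isGradedIdeal_idealOfPoint [Infinite K] (P : MPPoint K k n) :
    IsGradedIdeal (wt k n) (idealOfPoint K k n P) := by
  intro f hf d
  rw [mem_idealOfPoint] at hf ⊢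
  intro x hx
  let g : Sig k n → MvPolynomial (Fin k) K := fun p => C (x p) * X p.1
  have hg : ∀ p, IsWeightedHomogeneous (wtT k) (g p) (wt k n p) := by
    intro p
    rw [← zero_add (wt k n p)]
    exact (isWeightedHomogeneous_C _ _).mul (isWeightedHomogeneous_X K (wtT k) p.1)
  have heval : ∀ (t : Fin k → K) (h : MPRing K k n),
      eval t (aeval g h) = eval (fun p => x p * t p.1) h := by
    intro t h
    induction h using MvPolynomial.induction_on with
    | C a => simp
    | add p q hp hq => simp only [map_add, hp, hq]
    | mul_X p i hp => simp only [map_mul, hp, aeval_X, eval_X, g, eval_C]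
  have hzero : aeval g f = 0 := by
    refine MvPolynomial.funext fun t => ?_
    rw [heval, map_zero]
    refine hf _ fun i => ?_
    obtain ⟨c, hc⟩ := hx i
    refine ⟨t i * c, ?_⟩
    rw [mul_smul, ← hc]
    funext j
    simp [mul_comm]
  have h := weightedHomogeneousComponent_map (w := wt k n) (w' := wtT k) (aeval g)
    (fun f d hf => isWeightedHomogeneous_aeval g hg hf) f d
  rw [hzero, map_zero] at h
  have h1 := congrArg (eval (fun _ => (1 : K))) h
  rw [heval] at h1
  simpa using h1.symm

lemma isGradedIdeal_idealOfSet [Infinite K] (X : Set (MPPoint K k n)) :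
    IsGradedIdeal (wt k n) (idealOfSet K k n X) := by
  intro f hf d
  rw [mem_idealOfSet] at hf ⊢
  exact fun P hP => isGradedIdeal_idealOfPoint P f (hf P hP) d

/-- A linear form, monic in the first variable, which vanishes at no vector of a finite set. -/
lemma exists_coeff_sum_ne_zero [Infinite K] {N : ℕ} {S : Set (Fin (N + 1) → K)} (hS : S.Finite)
    (h0 : ∀ v ∈ S, v ≠ 0) : ∃ b : Fin (N + 1) → K, b 0 = 1 ∧ ∀ v ∈ S, ∑ j, b j * v j ≠ 0 := by
  have hfin : (insert (Pi.single 0 1) S).Finite := hS.insert _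
  have := hfin.to_subtype
  obtain ⟨f, hf⟩ := Module.exists_dual_forall_apply_ne_zero (K := K)
    (fun v : (insert (Pi.single 0 1) S : Set (Fin (N + 1) → K)) => (v : Fin (N + 1) → K))
    (by
      rintro ⟨v, rfl | hv⟩
      · simp
      · exact h0 v hv)
  have hf0 : f (Pi.single 0 1) ≠ 0 := hf ⟨_, Or.inl rfl⟩
  refine ⟨fun j => (f (Pi.single 0 1))⁻¹ * f (Pi.single j 1), inv_mul_cancel₀ hf0, fun v hv => ?_⟩
  have hfv : f v = ∑ j, f (Pi.single j 1) * v j := by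
    rw [LinearMap.pi_apply_eq_sum_univ f v]
    refine Finset.sum_congr rfl fun j _ => ?_
    rw [smul_eq_mul, mul_comm]
    congr 2
    funext l
    simp [Pi.single_apply, eq_comm]
  simp only [mul_assoc]
  rw [← Finset.mul_sum, ← hfv]
  exact mul_ne_zero (inv_ne_zero hf0) (hf ⟨v, Or.inr hv⟩)

/-- The linear form `∑ j, b i j * x_{i,j}` of degree `e_i`. -/
def linForm (b : ∀ i, Fin (n i + 1) → K) (i : Fin k) : MPRing K k n :=
  ∑ j, C (b i j) * X ⟨i, j⟩

lemma isWeightedHomogeneous_linForm (b : ∀ i, Fin (n i + 1) → K) (i : Fin k) :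
    IsWeightedHomogeneous (wt k n) (linForm b i) (Pi.single i 1) := by
  refine IsWeightedHomogeneous.sum _ _ _ fun j _ => ?_
  rw [← zero_add (Pi.single i 1)]
  exact (isWeightedHomogeneous_C _ _).mul (isWeightedHomogeneous_X K (wt k n) ⟨i, j⟩)

lemma linForm_mem_idealOfVars (b : ∀ i, Fin (n i + 1) → K) (i : Fin k) :
    linForm b i ∈ idealOfVars (Sig k n) K :=
  Ideal.sum_mem _ fun j _ => Ideal.mul_mem_left _ _ (Ideal.subset_span ⟨⟨i, j⟩, rfl⟩)

lemma idealOfVars_le_of_linForm_mem {b : ∀ i, Fin (n i + 1) → K} {X : Set (MPPoint K k n)}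
    (hX : X.Finite) (hb : ∀ i, ∀ P ∈ X, ∑ j, b i j * (P i).rep j ≠ 0)
    (Q : Ideal (MPRing K k n)) (hQ : Q.IsPrime) (hXQ : idealOfSet K k n X ≤ Q)
    (hLQ : ∀ i, linForm b i ∈ Q) : idealOfVars (Sig k n) K ≤ Q := by
  have hinf : hX.toFinset.inf (idealOfPoint K k n) ≤ Q := by
    rw [Finset.inf_eq_iInf]
    simpa [idealOfSet] using hXQ
  obtain ⟨P, hP, hPQ⟩ := hQ.inf_le'.1 hinf
  rw [Set.Finite.mem_toFinset] at hP
  rw [Ideal.span_le]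
  rintro _ ⟨⟨i, j⟩, rfl⟩
  have hmem : C (∑ l, b i l * (P i).rep l) * MvPolynomial.X ⟨i, j⟩ -
      C ((P i).rep j) * linForm b i ∈ idealOfPoint K k n P := by
    rw [mem_idealOfPoint]
    intro x hx
    obtain ⟨c, hc⟩ := hx i
    have hc' : ∀ l, x ⟨i, l⟩ = c * (P i).rep l := fun l => congrFun hc l
    simp only [linForm, map_sub, map_mul, map_sum, eval_C, eval_X, hc', Finset.mul_sum,
      Finset.sum_mul]
    rw [sub_eq_zero]
    exact Finset.sum_congr rfl fun l _ => by ring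
  have h := Q.add_mem (hPQ hmem) (Q.mul_mem_left (C ((P i).rep j)) (hLQ i))
  rw [sub_add_cancel] at h
  have h' := Q.mul_mem_left (C (∑ l, b i l * (P i).rep l)⁻¹) h
  rwa [← mul_assoc, ← C_mul, inv_mul_cancel₀ (hb i P hP), C_1, one_mul] at h'

end Geometry

section Projection

variable {K : Type} [Field K] {k : ℕ} {n : Fin k → ℕ}

/-- The projection `R → S` that eliminates the variables `x_{i,0}` using the linear forms
`linForm b i`, which are assumed to be monic in `x_{i,0}`. -/
def elim (b : ∀ i, Fin (n i + 1) → K) : MPRing K k n →ₐ[K] SRing K k n :=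
  aeval fun p => Fin.cases (motive := fun _ => SRing K k n)
    (-∑ j : Fin (n p.1), C (b p.1 j.succ) * X ⟨p.1, j⟩) (fun j => X ⟨p.1, j⟩) p.2

/-- The inclusion `S → R`. -/
def incl : SRing K k n →ₐ[K] MPRing K k n :=
  aeval fun p => X ⟨p.1, p.2.succ⟩

lemma elim_incl (b : ∀ i, Fin (n i + 1) → K) (f : SRing K k n) : elim b (incl f) = f := by
  have : (elim b).comp incl = AlgHom.id K (SRing K k n) := by
    ext1 p
    simp [elim, incl]
  exact DFunLike.congr_fun this f

lemma isWeightedHomogeneous_elim (b : ∀ i, Fin (n i + 1) → K) {f : MPRing K k n} {d : Fin k → ℕ}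
    (hf : IsWeightedHomogeneous (wt k n) f d) : IsWeightedHomogeneous (wtS k n) (elim b f) d := by
  refine isWeightedHomogeneous_aeval _ ?_ hf
  rintro ⟨i, j⟩
  induction j using Fin.cases with
  | zero =>
    refine (weightedHomogeneousSubmodule K (wtS k n) _).neg_mem
      (IsWeightedHomogeneous.sum _ _ _ fun j _ => ?_)
    rw [← zero_add (wt k n _)]
    exact (isWeightedHomogeneous_C _ _).mul (isWeightedHomogeneous_X K (wtS k n) ⟨i, j⟩)
  | succ j => exact isWeightedHomogeneous_X K (wtS k n) ⟨i, j⟩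

lemma isWeightedHomogeneous_incl {f : SRing K k n} {d : Fin k → ℕ}
    (hf : IsWeightedHomogeneous (wtS k n) f d) : IsWeightedHomogeneous (wt k n) (incl f) d := by
  unfold incl
  exact isWeightedHomogeneous_aeval (w := wtS k n) _
    (fun p => isWeightedHomogeneous_X K (wt k n) (⟨p.1, p.2.succ⟩ : Sig k n)) hf

lemma map_elim_weightedHomogeneousSubmodule (b : ∀ i, Fin (n i + 1) → K) (d : Fin k → ℕ) :
    (weightedHomogeneousSubmodule K (wt k n) d).map (elim b).toLinearMap =
      weightedHomogeneousSubmodule K (wtS k n) d := by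
  refine le_antisymm ?_ fun f hf => ⟨incl f, ?_, elim_incl b f⟩
  · rintro _ ⟨f, hf, rfl⟩
    exact isWeightedHomogeneous_elim b hf
  · exact isWeightedHomogeneous_incl hf

lemma ker_elim_le {b : ∀ i, Fin (n i + 1) → K} (hb : ∀ i, b i 0 = 1) :
    RingHom.ker (elim b) ≤ Ideal.span (Set.range (linForm b)) := by
  have h : ((Ideal.Quotient.mkₐ K (Ideal.span (Set.range (linForm b)))).comp incl).comp (elim b) =
      Ideal.Quotient.mkₐ K (Ideal.span (Set.range (linForm b))) := by
    refine MvPolynomial.algHom_ext ?_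
    rintro ⟨i, j⟩
    induction j using Fin.cases with
    | zero =>
      refine (Ideal.Quotient.eq.2 ?_).symm
      have : X ⟨i, 0⟩ - incl (elim b (X ⟨i, 0⟩)) = linForm b i := by
        simp [elim, incl, linForm, Fin.sum_univ_succ, hb]
      exact this ▸ Ideal.subset_span ⟨i, rfl⟩
    | succ j => simp [elim, incl]
  intro f hf
  have hf' := DFunLike.congr_fun h f
  rw [AlgHom.comp_apply, RingHom.mem_ker.1 hf, map_zero] at hf'
  exact Ideal.Quotient.eq_zero_iff_mem.1 hf'.symm

end Projection


lemma IsACM.depthAtLeast {K : Type} [Field K] {k : ℕ} {n : Fin k → ℕ}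
    {X : Set (MPPoint K k n)} (h : IsACM K k n X) :
    DepthAtLeast (idealOfVars (Sig k n) K) k (idealOfSet K k n X) := by
  obtain ⟨L, hL, hm, hreg⟩ := h.1
  have := depthAtLeast_length L (idealOfSet K k n X)
    (fun x hx => hm (Ideal.mem_sup_right (Ideal.subset_span hx))) hreg
  rwa [hL] at this

/-- if `X` is an ACM set of points, then `ΔH_X` is the Hilbert function
of an `ℕ^k`-graded artinian quotient of `S = k[x_{1,1},…,x_{k,n_k}]`. -/
theorem statement_4 (K : Type) [Field K] [IsAlgClosed K] [CharZero K]
    (k : ℕ) (n : Fin k → ℕ)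
    (X : Set (MPPoint K k n)) (hX : X.Finite) (hACM : IsACM K k n X) :
    ∃ J : Ideal (SRing K k n), IsHomogIdealS K k n J ∧ IsArtinianIdealS K k n J ∧
      ∀ d : Fin k → ℕ,
        (hilbS K k n J d : ℤ) = delta k (hilb K k n (idealOfSet K k n X)) d := by
  have hb : ∀ i, ∃ b : Fin (n i + 1) → K, b 0 = 1 ∧
      ∀ v ∈ (fun P : MPPoint K k n => (P i).rep) '' X, ∑ j, b j * v j ≠ 0 := by
    intro i
    refine exists_coeff_sum_ne_zero (hX.image _) ?_
    rintro _ ⟨P, _, rfl⟩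
    exact (P i).rep_nonzero
  choose b hb0 hb using hb
  have hL := isWeightedHomogeneous_linForm b
  have hmin := idealOfVars_le_of_linForm_mem hX fun i P hP => hb i _ ⟨P, hP, rfl⟩
  have hw : ∀ p : Sig k n, ∃ i, wt k n p i ≠ 0 := fun p => Function.ne_iff.1 (wt_ne_zero p)
  have hI := isGradedIdeal_idealOfSet X
  have hreg := regMod_sup_span_image wt_ne_zero hI hL (linForm_mem_idealOfVars b) hmin
    hACM.depthAtLeast
  let J : Ideal (MPRing K k n) :=
    idealOfSet K k n X ⊔ Ideal.span (linForm b '' (Finset.univ : Finset (Fin k)))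
  have hLJ : ∀ i, linForm b i ∈ J := fun i =>
    Ideal.mem_sup_right (Ideal.subset_span ⟨i, by simp, rfl⟩)
  have hJm : J ≤ idealOfVars (Sig k n) K := by
    obtain ⟨L, -, hm, -⟩ := hACM.1
    refine sup_le (le_sup_left.trans hm) (Ideal.span_le.2 ?_)
    rintro _ ⟨i, -, rfl⟩
    exact linForm_mem_idealOfVars b i
  have hsurj : Function.Surjective (elim b) := fun f => ⟨incl f, elim_incl b f⟩
  have hker : RingHom.ker (elim b) ≤ J := by
    refine (ker_elim_le hb0).trans (Ideal.span_le.2 ?_)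
    rintro _ ⟨i, rfl⟩
    exact hLJ i
  refine ⟨J.map (elim b), ?_, ?_, fun d => ?_⟩
  · intro f hf d
    obtain ⟨g, hg, rfl⟩ := (Ideal.mem_map_iff_of_surjective _ hsurj).1 hf
    rw [weightedHomogeneousComponent_map (elim b) fun f d => isWeightedHomogeneous_elim b]
    exact Ideal.mem_map_of_mem _ (hI.sup_span_image hL _ g hg d)
  · refine le_antisymm ?_ ?_
    · refine (isPrime_idealOfVars (K := K)).isRadical.radical_le_iff.2
        ((Ideal.map_mono hJm).trans ?_)
      rw [Ideal.map_span, Ideal.span_le]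
      rintro _ ⟨_, ⟨⟨i, j⟩, rfl⟩, rfl⟩
      induction j using Fin.cases with
      | zero =>
        simp only [elim, aeval_X, Fin.cases_zero]
        exact neg_mem (Ideal.sum_mem _ fun j _ =>
          Ideal.mul_mem_left _ _ (Ideal.subset_span ⟨⟨i, j⟩, rfl⟩))
      | succ j =>
        simp only [elim, aeval_X, Fin.cases_succ]
        exact Ideal.subset_span ⟨⟨i, j⟩, rfl⟩
    · rw [Ideal.radical_eq_sInf]
      refine le_sInf ?_
      rintro Q ⟨hJQ, hQ⟩
      have hJQ' : J ≤ Q.comap (elim b) := Ideal.map_le_iff_le_comap.1 hJQ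
      have h := hmin (Q.comap (elim b)) (hQ.comap _) (le_sup_left.trans hJQ')
        fun i => hJQ' (hLJ i)
      rw [Ideal.span_le]
      rintro _ ⟨p, rfl⟩
      have hp : elim b (MvPolynomial.X ⟨p.1, p.2.succ⟩) ∈ Q :=
        h (Ideal.subset_span ⟨⟨p.1, p.2.succ⟩, rfl⟩)
      simpa [elim] using hp
  · have h1 : hilbS K k n (J.map (elim b)) d = hilbGen (wt k n) J d :=
      hilbGen_map (elim b) hker hsurj (map_elim_weightedHomogeneousSubmodule b) d
    rw [h1, ← extNeg_natCast (hilbGen (wt k n) J), delta_eq_sum_powerset]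
    exact extNeg_hilbGen_sup_span_image hw hI hL hreg _ _

end PaperMP
end
end
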